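/- Let α be a nonnegative integer and let h ∈ C_c^∞((0,2)) satisfy, for every s ∈ (0,1), ∫_0^{1-s} t^{1-2α} h(t) ([(1+t)^2-s^2][(1-t)^2-s^2])^{α-1/2} dt = ∫_{1+s}^{2} t^{1-2α} h(t) ([(1+t)^2-s^2][(1-t)^2-s^2])^{α-1/2} dt. Then for every λ > 0, y_α(λ) · ∫_0^2 t h(t) j_α(λ t) dt = j_α(λ) · ∫_0^2 t h(t) y_α(λ t) dt. -/

import Mathlib

/-- Bessel function of the first kind of integer order `α`:
`J_α(x) = Σ_{k≥0} (-1)^k (x/2)^{2k+α} / (k! (k+α)!)`. -/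
noncomputable def besselJ (α : ℕ) (x : ℝ) : ℝ :=
  ∑' k : ℕ, (-1 : ℝ) ^ k * (x / 2) ^ (2 * k + α) /
    ((Nat.factorial k : ℝ) * (Nat.factorial (k + α) : ℝ))

/-- Partial harmonic sum `H_k = Σ_{i=1}^k 1/i`. -/
noncomputable def harmonicSum (k : ℕ) : ℝ := ∑ i ∈ Finset.range k, (1 : ℝ) / (i + 1)

/-- Bessel function of the second kind of integer order `α`. -/
noncomputable def besselY (α : ℕ) (x : ℝ) : ℝ :=
  (2 / Real.pi) * (Real.log (x / 2) + Real.eulerMascheroniConstant) * besselJ α x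
    - (1 / Real.pi) * ∑ k ∈ Finset.range α,
        ((Nat.factorial (α - k - 1) : ℝ) / (Nat.factorial k : ℝ)) *
          (x / 2) ^ (2 * (k : ℤ) - (α : ℤ))
    - (1 / Real.pi) * ∑' k : ℕ,
        (-1 : ℝ) ^ k * (harmonicSum k + harmonicSum (k + α)) /
            ((Nat.factorial k : ℝ) * (Nat.factorial (k + α) : ℝ)) *
          (x / 2) ^ (2 * k + α)

/-- Normalized Bessel function of the first kind: `j_α(x) = 2^α α! J_α(x) / x^α`. -/
noncomputable def besselj (α : ℕ) (x : ℝ) : ℝ :=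
  2 ^ α * (Nat.factorial α : ℝ) * besselJ α x / x ^ α

/-- Normalized Bessel function of the second kind: `y_α(x) = 2^α α! Y_α(x) / x^α`. -/
noncomputable def bessely (α : ℕ) (x : ℝ) : ℝ :=
  2 ^ α * (Nat.factorial α : ℝ) * besselY α x / x ^ α

open MeasureTheory Set Filter Topology

/-- Leibniz rule for `∫ η in 0..a, f a η` with a jointly `C¹` integrand. -/
lemma hasDerivAt_integral_zero_self {f f' : ℝ → ℝ → ℝ}
    (hf : Continuous fun p : ℝ × ℝ => f p.1 p.2)
    (hf' : Continuous fun p : ℝ × ℝ => f' p.1 p.2)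
    (hd : ∀ a η, HasDerivAt (fun s => f s η) (f' a η) a) (a : ℝ) :
    HasDerivAt (fun s => ∫ η in (0 : ℝ)..s, f s η) (f a a + ∫ η in (0 : ℝ)..a, f' a η) a := by
  have h1 : ∀ x y : ℝ, HasDerivAt (fun b => ∫ η in (0 : ℝ)..b, f y η) (f y x) x := fun x y =>
    ((by fun_prop : Continuous fun η => f y η).integral_hasStrictDerivAt 0 x).hasDerivAt
  have h2 : ∀ x y : ℝ, HasDerivAt (fun s => ∫ η in (0 : ℝ)..x, f s η)
      (∫ η in (0 : ℝ)..x, f' y η) y := by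
    intro x y
    obtain ⟨C, hC⟩ := ((isCompact_closedBall y 1).prod (isCompact_uIcc (a := (0 : ℝ)) (b := x)))
      |>.exists_bound_of_continuousOn hf'.continuousOn
    refine (intervalIntegral.hasDerivAt_integral_of_dominated_loc_of_deriv_le
      (F := fun s η => f s η) (F' := fun s η => f' s η) (bound := fun _ => C)
      (Metric.closedBall_mem_nhds y one_pos)
      (Eventually.of_forall fun s => (by fun_prop : Continuous fun η => f s η).aestronglyMeasurable)
      ((by fun_prop : Continuous fun η => f y η).intervalIntegrable _ _)
      (by fun_prop : Continuous fun η => f' y η).aestronglyMeasurable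
      (Eventually.of_forall fun η hη s hs => hC (s, η) ⟨hs, uIoc_subset_uIcc hη⟩)
      intervalIntegrable_const
      (Eventually.of_forall fun η _ s _ => hd s η)).2
  have c2 : Continuous fun p : ℝ × ℝ => ∫ η in (0 : ℝ)..p.1, f' p.2 η :=
    intervalIntegral.continuous_parametric_intervalIntegral_of_continuous (by fun_prop)
      continuous_fst
  have key := hasStrictFDerivAt_uncurry_coprod (𝕜 := ℝ) (u := ((a, a) : ℝ × ℝ))
    (f := fun b s => ∫ η in (0 : ℝ)..b, f s η)
    (f₁ := fun b s => ContinuousLinearMap.toSpanSingleton ℝ (f s b))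
    (f₂ := fun b s => ContinuousLinearMap.toSpanSingleton ℝ (∫ η in (0 : ℝ)..b, f' s η))
    (Eventually.of_forall fun v => (h1 v.1 v.2).hasFDerivAt)
    (Eventually.of_forall fun v => (h2 v.1 v.2).hasFDerivAt)
    (by
      refine Continuous.continuousAt ?_
      exact (ContinuousLinearMap.toSpanSingletonCLE (𝕜 := ℝ) (E := ℝ)).continuous.comp
        (by fun_prop : Continuous fun p : ℝ × ℝ => f p.2 p.1))
    (by
      refine Continuous.continuousAt ?_
      exact (ContinuousLinearMap.toSpanSingletonCLE (𝕜 := ℝ) (E := ℝ)).continuous.comp c2)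
  have := HasFDerivAt.comp_hasDerivAt (f := fun s : ℝ => (s, s)) a key.hasFDerivAt
    ((hasDerivAt_id a).prodMk (hasDerivAt_id a))
  simpa [Function.HasUncurry.uncurry, Function.comp_def] using this

/-- The Gegenbauer-type integral `∫_0^Y (cosh Y - cosh η)^m cosh (n η) dη`. -/
noncomputable def coshIntegral (n m : ℕ) (Y : ℝ) : ℝ :=
  ∫ η in (0 : ℝ)..Y, (Real.cosh Y - Real.cosh η) ^ m * Real.cosh (n * η)

lemma coshIntegral_zero (n m : ℕ) : coshIntegral n m 0 = 0 := by simp [coshIntegral]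

lemma hasDerivAt_coshIntegral_zero (n : ℕ) (Y : ℝ) :
    HasDerivAt (coshIntegral n 0) (Real.cosh (n * Y)) Y := by
  have := hasDerivAt_integral_zero_self (f := fun _ η => Real.cosh (n * η))
    (f' := fun _ _ => 0) (by fun_prop) (by fun_prop)
    (fun a η => by simpa using hasDerivAt_const a _) Y
  rw [intervalIntegral.integral_zero, add_zero] at this
  refine this.congr_of_eventuallyEq (Eventually.of_forall fun s => ?_)
  simp [coshIntegral]

lemma hasDerivAt_coshIntegral_succ (n m : ℕ) (Y : ℝ) :
    HasDerivAt (coshIntegral n (m + 1)) ((m + 1) * Real.sinh Y * coshIntegral n m Y) Y := by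
  have := hasDerivAt_integral_zero_self
    (f := fun Y η => (Real.cosh Y - Real.cosh η) ^ (m + 1) * Real.cosh (n * η))
    (f' := fun Y η => ((m + 1) * Real.sinh Y) *
      ((Real.cosh Y - Real.cosh η) ^ m * Real.cosh (n * η))) (by fun_prop) (by fun_prop)
    (fun a η => by
      have h := (((Real.hasDerivAt_cosh a).sub_const (Real.cosh η)).pow (m + 1)).mul_const
        (Real.cosh (n * η))
      refine h.congr_deriv ?_
      push_cast
      ring) Y
  rw [intervalIntegral.integral_const_mul] at this
  simpa [coshIntegral] using! this

lemma coshIntegral_succ_left (n m : ℕ) (Y : ℝ) :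
    coshIntegral (n + 1) m Y = Real.cosh Y * coshIntegral n m Y - coshIntegral n (m + 1) Y
      + n / (m + 1) * coshIntegral n (m + 1) Y := by
  have hm : (m + 1 : ℝ) ≠ 0 := by positivity
  have hder : ∀ η ∈ uIcc 0 Y, HasDerivAt
      (fun η => -(Real.cosh Y - Real.cosh η) ^ (m + 1) / (m + 1) * Real.sinh (n * η))
      ((Real.cosh Y - Real.cosh η) ^ m * Real.sinh η * Real.sinh (n * η)
        - n / (m + 1) * ((Real.cosh Y - Real.cosh η) ^ (m + 1) * Real.cosh (n * η))) η := by
    intro η _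
    have h1 := ((((Real.hasDerivAt_cosh η).const_sub (Real.cosh Y)).pow (m + 1)).neg).div_const
      (m + 1 : ℝ)
    have h2 := ((hasDerivAt_id η).const_mul (n : ℝ)).sinh
    refine (h1.mul h2).congr_deriv ?_
    simp
    field_simp
    ring
  have hint := intervalIntegral.integral_eq_sub_of_hasDerivAt hder
    (Continuous.intervalIntegrable (by fun_prop) _ _)
  rw [intervalIntegral.integral_sub (Continuous.intervalIntegrable (by fun_prop) _ _)
    (Continuous.intervalIntegrable (by fun_prop) _ _),
    intervalIntegral.integral_const_mul] at hint
  have hcosh : ∀ η : ℝ, (Real.cosh Y - Real.cosh η) ^ m * Real.cosh ((n + 1 : ℕ) * η)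
      = Real.cosh Y * ((Real.cosh Y - Real.cosh η) ^ m * Real.cosh (n * η))
        - (Real.cosh Y - Real.cosh η) ^ (m + 1) * Real.cosh (n * η)
        + (Real.cosh Y - Real.cosh η) ^ m * Real.sinh η * Real.sinh (n * η) := by
    intro η
    have : ((n + 1 : ℕ) : ℝ) * η = n * η + η := by push_cast; ring
    rw [this, Real.cosh_add]
    ring
  unfold coshIntegral
  simp_rw [hcosh]
  rw [intervalIntegral.integral_add (Continuous.intervalIntegrable (by fun_prop) _ _)
    (Continuous.intervalIntegrable (by fun_prop) _ _),
    intervalIntegral.integral_sub (Continuous.intervalIntegrable (by fun_prop) _ _)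
    (Continuous.intervalIntegrable (by fun_prop) _ _),
    intervalIntegral.integral_const_mul]
  simp at hint
  linarith

/-- A differentiable function is determined by its derivative and its value at `0`. -/
lemma eq_of_hasDerivAt_of_eq_zero {f g f' : ℝ → ℝ} (hf : ∀ x, HasDerivAt f (f' x) x)
    (hg : ∀ x, HasDerivAt g (f' x) x) (h0 : f 0 = g 0) : f = g := by
  funext x
  have h : ∀ x, HasDerivAt (fun x => f x - g x) 0 x := fun x =>
    ((hf x).sub (hg x)).congr_deriv (sub_self _)
  have := is_const_of_deriv_eq_zero (fun x => (h x).differentiableAt) (fun x => (h x).deriv) x 0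
  simp only [h0, sub_self] at this
  linarith

lemma hasDerivAt_coshIntegral_succ_self (n : ℕ) {f : ℝ} {Y : ℝ}
    (h : HasDerivAt (coshIntegral n n) f Y) :
    HasDerivAt (coshIntegral (n + 1) n) (Real.cosh Y * f) Y := by
  have e : coshIntegral (n + 1) n = fun Y => Real.cosh Y * coshIntegral n n Y
      - 1 / (n + 1) * coshIntegral n (n + 1) Y := by
    funext Y
    rw [coshIntegral_succ_left]
    have hm : (n + 1 : ℝ) ≠ 0 := by positivity
    field_simp
    ring
  rw [e]
  refine (((Real.hasDerivAt_cosh Y).mul h).sub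
    ((hasDerivAt_coshIntegral_succ n n Y).const_mul _)).congr_deriv ?_
  field_simp
  ring

lemma exists_hasDerivAt_coshIntegral_self (n : ℕ) :
    ∃ κ : ℝ, ∀ Y, HasDerivAt (coshIntegral n n) (κ * Real.sinh Y ^ (2 * n)) Y := by
  induction n with
  | zero => exact ⟨1, fun Y => by simpa using hasDerivAt_coshIntegral_zero 0 Y⟩
  | succ n ih =>
    obtain ⟨κ, hκ⟩ := ih
    have hm : (2 * n + 1 : ℝ) ≠ 0 := by positivity
    have e : coshIntegral (n + 1) n = fun Y => κ / (2 * n + 1) * Real.sinh Y ^ (2 * n + 1) := by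
      refine eq_of_hasDerivAt_of_eq_zero
        (fun Y => hasDerivAt_coshIntegral_succ_self n (hκ Y)) (fun Y => ?_) ?_
      · refine (((Real.hasDerivAt_sinh Y).pow (2 * n + 1)).const_mul _).congr_deriv ?_
        push_cast
        field_simp
      · simp [coshIntegral_zero]
    refine ⟨(n + 1) * κ / (2 * n + 1), fun Y => ?_⟩
    refine (hasDerivAt_coshIntegral_succ (n + 1) n Y).congr_deriv ?_
    rw [e]
    field_simp
    ring

/-- `∫_0^Y (cosh Y - cosh η)^n cosh (n η) dη` is a multiple of `∫_0^Y sinh^{2n}`. -/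
lemma exists_coshIntegral_self_eq (n : ℕ) :
    ∃ κ : ℝ, ∀ Y, coshIntegral n n Y = κ * ∫ r in (0 : ℝ)..Y, Real.sinh r ^ (2 * n) := by
  obtain ⟨κ, hκ⟩ := exists_hasDerivAt_coshIntegral_self n
  refine ⟨κ, fun Y => ?_⟩
  have := intervalIntegral.integral_eq_sub_of_hasDerivAt (fun x _ => hκ x)
    (Continuous.intervalIntegrable (by fun_prop) 0 Y)
  rw [intervalIntegral.integral_const_mul, coshIntegral_zero, sub_zero] at this
  exact this.symm

/-- Coefficient sequences of exponential type: `|c k| ≤ M C ^ k / k!`. -/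
def EntireCoeff (c : ℕ → ℝ) : Prop :=
  ∃ M C : ℝ, 0 ≤ M ∧ 0 ≤ C ∧ ∀ k, |c k| ≤ M * C ^ k / (Nat.factorial k : ℝ)

/-- The real power series with coefficients `c`. -/
noncomputable def powSer (c : ℕ → ℝ) (x : ℝ) : ℝ := ∑' k, c k * x ^ k

namespace EntireCoeff

variable {c d : ℕ → ℝ}

lemma summable_bound (M C R : ℝ) :
    Summable fun k : ℕ => M * C ^ k / (Nat.factorial k : ℝ) * R ^ k := by
  refine ((Real.summable_pow_div_factorial (C * R)).mul_left M).congr fun k => ?_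
  rw [mul_pow]
  ring

lemma norm_le {M C : ℝ} (hc : ∀ k, |c k| ≤ M * C ^ k / (Nat.factorial k : ℝ)) {x R : ℝ}
    (hx : |x| ≤ R) (k : ℕ) : ‖c k * x ^ k‖ ≤ M * C ^ k / (Nat.factorial k : ℝ) * R ^ k := by
  rw [Real.norm_eq_abs, abs_mul, abs_pow]
  exact mul_le_mul (hc k) (pow_le_pow_left₀ (abs_nonneg x) hx k) (by positivity)
    ((abs_nonneg _).trans (hc k))

lemma summable (hc : EntireCoeff c) (x : ℝ) : Summable fun k => c k * x ^ k := by
  obtain ⟨M, C, -, -, h⟩ := hc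
  exact Summable.of_norm_bounded (summable_bound M C |x|) (norm_le h le_rfl)

lemma shift (hc : EntireCoeff c) : EntireCoeff fun k => (k + 1) * c (k + 1) := by
  obtain ⟨M, C, hM, hC, h⟩ := hc
  refine ⟨M * C, C, by positivity, hC, fun k => ?_⟩
  have h1 := h (k + 1)
  rw [abs_mul, abs_of_nonneg (by positivity : (0 : ℝ) ≤ k + 1)]
  refine (mul_le_mul_of_nonneg_left h1 (by positivity)).trans (le_of_eq ?_)
  rw [Nat.factorial_succ]
  push_cast
  field_simp
  ring

lemma of_le_two_pow (hc : EntireCoeff c) {K : ℝ} (hK : 0 ≤ K)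
    (hd : ∀ k, |d k| ≤ K * 2 ^ k * |c k|) : EntireCoeff d := by
  obtain ⟨M, C, hM, hC, h⟩ := hc
  refine ⟨K * M, 2 * C, by positivity, by positivity, fun k => (hd k).trans ?_⟩
  refine (mul_le_mul_of_nonneg_left (h k) (by positivity)).trans (le_of_eq ?_)
  rw [mul_pow]
  ring

lemma affine_mul (hc : EntireCoeff c) (a b : ℝ) : EntireCoeff fun k => (a * k + b) * c k := by
  refine hc.of_le_two_pow (K := |a| + |b|) (by positivity) fun k => ?_
  rw [abs_mul]
  refine mul_le_mul_of_nonneg_right ?_ (abs_nonneg _)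
  have h1 : (k : ℝ) ≤ 2 ^ k := by exact_mod_cast (Nat.lt_two_pow_self).le
  have h2 : (1 : ℝ) ≤ 2 ^ k := one_le_pow₀ (by norm_num)
  calc |a * k + b| ≤ |a| * k + |b| := by
        refine (abs_add_le _ _).trans ?_
        rw [abs_mul, Nat.abs_cast]
    _ ≤ |a| * 2 ^ k + |b| * 2 ^ k :=
        add_le_add (mul_le_mul_of_nonneg_left h1 (abs_nonneg _))
          (le_mul_of_one_le_right (abs_nonneg _) h2)
    _ = (|a| + |b|) * 2 ^ k := by ring

lemma of_finite {n : ℕ} (h : ∀ k, n ≤ k → c k = 0) : EntireCoeff c := by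
  refine ⟨∑ k ∈ Finset.range n, |c k| * (Nat.factorial k : ℝ), 1, by positivity, by positivity,
    fun k => ?_⟩
  rcases lt_or_ge k n with hk | hk
  · rw [one_pow, mul_one, le_div_iff₀ (by positivity)]
    exact Finset.single_le_sum (f := fun k => |c k| * (Nat.factorial k : ℝ))
      (fun i _ => by positivity) (Finset.mem_range.2 hk)
  · rw [h k hk, abs_zero]
    positivity

lemma hasDerivAt (hc : EntireCoeff c) (x : ℝ) :
    HasDerivAt (powSer c) (powSer (fun k => (k + 1) * c (k + 1)) x) x := by
  obtain ⟨M, C, hM, hC, h⟩ := hc.shift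
  have hs : Summable fun k : ℕ =>
      M * C ^ k / (Nat.factorial k : ℝ) * (|x| + 1) ^ k := summable_bound _ _ _
  have hder : ∀ (k : ℕ) (y : ℝ), y ∈ Metric.ball (0 : ℝ) (|x| + 1) →
      HasDerivAt (fun y => c (k + 1) * y ^ (k + 1)) ((k + 1) * c (k + 1) * y ^ k) y := by
    intro k y _
    refine ((hasDerivAt_pow (k + 1) y).const_mul _).congr_deriv ?_
    push_cast
    ring
  have key := hasDerivAt_tsum_of_isPreconnected hs Metric.isOpen_ball
    (convex_ball (0 : ℝ) (|x| + 1)).isPreconnected hder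
    (fun k y hy => norm_le h (by simpa using (mem_ball_zero_iff.1 hy).le) k)
    (y₀ := x) (y := x) (by simp) ((summable_nat_add_iff 1).2 (hc.summable x)) (by simp)
  have e : powSer c = fun z => c 0 + ∑' k, c (k + 1) * z ^ (k + 1) := by
    funext z
    rw [powSer, (hc.summable z).tsum_eq_zero_add]
    simp
  rw [e]
  exact key.const_add _

lemma continuous (hc : EntireCoeff c) : Continuous (powSer c) :=
  continuous_iff_continuousAt.2 fun x => (hc.hasDerivAt x).continuousAt

lemma mul_powSer_shift (hc : EntireCoeff c) (x : ℝ) :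
    x * powSer (fun k => (k + 1) * c (k + 1)) x = powSer (fun k => k * c k) x := by
  have h : Summable fun k => (k * c k) * x ^ k := by
    simpa using (hc.affine_mul 1 0).summable x
  rw [powSer, powSer, h.tsum_eq_zero_add, ← tsum_mul_left]
  simp only [Nat.cast_zero, zero_mul, zero_add]
  refine tsum_congr fun k => ?_
  push_cast
  ring

end EntireCoeff

/-- The Frobenius series `∑ c k q ^ k e ^ {-(2 k + σ) τ}`. -/
noncomputable def frobeniusSeries (σ q : ℝ) (c : ℕ → ℝ) (τ : ℝ) : ℝ :=
  Real.exp (-(σ * τ)) * powSer c (q * Real.exp (-(2 * τ)))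

lemma hasDerivAt_frobeniusSeries {c : ℕ → ℝ} (hc : EntireCoeff c) (σ q τ : ℝ) :
    HasDerivAt (frobeniusSeries σ q c)
      (frobeniusSeries σ q (fun k => ((-2) * k + (-σ)) * c k) τ) τ := by
  have hz : HasDerivAt (fun τ => q * Real.exp (-(2 * τ)))
      (-2 * (q * Real.exp (-(2 * τ)))) τ := by
    refine ((((hasDerivAt_id τ).const_mul (2 : ℝ)).neg.exp).const_mul q).congr_deriv ?_
    simp
    ring
  have he : HasDerivAt (fun τ => Real.exp (-(σ * τ))) (-σ * Real.exp (-(σ * τ))) τ := by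
    refine (((hasDerivAt_id τ).const_mul σ).neg.exp).congr_deriv ?_
    simp
    ring
  refine (he.mul ((hc.hasDerivAt _).comp τ hz)).congr_deriv ?_
  set z := q * Real.exp (-(2 * τ))
  have h1 := hc.mul_powSer_shift z
  have h2 : powSer (fun k => ((-2) * k + (-σ)) * c k) z
      = -2 * powSer (fun k => k * c k) z + -σ * powSer c z := by
    have hs : Summable fun k => (k * c k) * z ^ k := by
      simpa using (hc.affine_mul 1 0).summable z
    rw [powSer, powSer, powSer, ← tsum_mul_left, ← tsum_mul_left,
      ← (hs.mul_left _).tsum_add ((hc.summable z).mul_left _)]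
    exact tsum_congr fun k => by ring
  rw [frobeniusSeries, h2, ← h1]
  simp only [Function.comp]
  ring

/-- A recursion for the coefficients turns into a differential equation for the series. -/
lemma frobeniusSeries_second_deriv {c r : ℕ → ℝ} (hc : EntireCoeff c) (hr : EntireCoeff r)
    (σ q τ : ℝ) (h0 : r 0 = 0)
    (hrec : ∀ k : ℕ, 4 * (k + 1) * (k + 1 + σ) * c (k + 1) + 4 * c k = r (k + 1)) :
    frobeniusSeries σ q (fun k => ((-2) * k + (-σ)) * (((-2) * k + (-σ)) * c k)) τ
      = (σ ^ 2 - 4 * (q * Real.exp (-(2 * τ)))) * frobeniusSeries σ q c τ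
        + frobeniusSeries σ q r τ := by
  simp only [frobeniusSeries]
  set z := q * Real.exp (-(2 * τ))
  have hc2 := (hc.affine_mul (-2) (-σ)).affine_mul (-2) (-σ)
  suffices powSer (fun k => ((-2) * k + (-σ)) * (((-2) * k + (-σ)) * c k)) z
      = (σ ^ 2 - 4 * z) * powSer c z + powSer r z by rw [this]; ring
  have e1 : powSer (fun k => ((-2) * k + (-σ)) * (((-2) * k + (-σ)) * c k)) z
      - σ ^ 2 * powSer c z - powSer r z
      = ∑' k, ((((-2) * k + (-σ)) * (((-2) * k + (-σ)) * c k)) * z ^ k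
        - σ ^ 2 * (c k * z ^ k) - r k * z ^ k) := by
    rw [powSer, powSer, powSer, ← tsum_mul_left,
      ((hc2.summable z).sub ((hc.summable z).mul_left _)).tsum_sub (hr.summable z),
      (hc2.summable z).tsum_sub ((hc.summable z).mul_left _)]
  have hs := (((hc2.summable z).sub ((hc.summable z).mul_left (σ ^ 2))).sub (hr.summable z))
  rw [hs.tsum_eq_zero_add] at e1
  have e2 : ∑' k : ℕ, ((((-2) * ((k + 1 : ℕ) : ℝ) + (-σ)) * (((-2) * ((k + 1 : ℕ) : ℝ) + (-σ))
        * c (k + 1))) * z ^ (k + 1) - σ ^ 2 * (c (k + 1) * z ^ (k + 1)) - r (k + 1) * z ^ (k + 1))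
      = -4 * z * powSer c z := by
    rw [powSer, ← tsum_mul_left]
    refine tsum_congr fun k => ?_
    rw [← hrec k]
    push_cast
    ring
  rw [e2] at e1
  simp only [h0, Nat.cast_zero, pow_zero] at e1
  linear_combination e1

/-- Solutions of Bessel's equation of order `α` in the variable `τ = -log (x / lam)`. -/
def SolvesBessel (α : ℕ) (lam : ℝ) (u : ℝ → ℝ) : Prop :=
  ∃ u' : ℝ → ℝ, (∀ τ, HasDerivAt u (u' τ) τ) ∧
    ∀ τ, HasDerivAt u' ((α ^ 2 - lam ^ 2 * Real.exp (-(2 * τ))) * u τ) τ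

namespace SolvesBessel

variable {α : ℕ} {lam : ℝ} {u v : ℝ → ℝ}

lemma const_mul (hu : SolvesBessel α lam u) (a : ℝ) : SolvesBessel α lam fun τ => a * u τ := by
  obtain ⟨u', h1, h2⟩ := hu
  exact ⟨fun τ => a * u' τ, fun τ => (h1 τ).const_mul a,
    fun τ => ((h2 τ).const_mul a).congr_deriv (by ring)⟩

lemma sub (hu : SolvesBessel α lam u) (hv : SolvesBessel α lam v) :
    SolvesBessel α lam fun τ => u τ - v τ := by
  obtain ⟨u', h1, h2⟩ := hu
  obtain ⟨v', h3, h4⟩ := hv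
  exact ⟨fun τ => u' τ - v' τ, fun τ => (h1 τ).sub (h3 τ),
    fun τ => ((h2 τ).sub (h4 τ)).congr_deriv (by ring)⟩

lemma continuous (hu : SolvesBessel α lam u) : Continuous u := by
  obtain ⟨u', h1, -⟩ := hu
  exact continuous_iff_continuousAt.2 fun x => (h1 x).continuousAt

/-- A solution with vanishing Cauchy data at `0` vanishes identically. -/
lemma eq_zero {u' : ℝ → ℝ} (h1 : ∀ τ, HasDerivAt u (u' τ) τ)
    (h2 : ∀ τ, HasDerivAt u' ((α ^ 2 - lam ^ 2 * Real.exp (-(2 * τ))) * u τ) τ)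
    (h0 : u 0 = 0) (h0' : u' 0 = 0) (τ : ℝ) : u τ = 0 := by
  set R := |τ| + 1
  set Q : ℝ := α ^ 2 + lam ^ 2 * Real.exp (2 * R)
  have hQ : 0 ≤ Q := by positivity
  let V : ℝ → ℝ × ℝ → ℝ × ℝ := fun s p =>
    (p.2, (α ^ 2 - lam ^ 2 * Real.exp (-(2 * s))) * p.1)
  have hV : ∀ s ∈ Ioo (-R) R, LipschitzOnWith (Real.toNNReal (max 1 Q)) (V s) univ := by
    intro s hs
    refine LipschitzWith.lipschitzOnWith (LipschitzWith.of_dist_le_mul fun p p' => ?_)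
    rw [Real.coe_toNNReal _ (by positivity)]
    have hq : |α ^ 2 - lam ^ 2 * Real.exp (-(2 * s))| ≤ Q := by
      have hexp : Real.exp (-(2 * s)) ≤ Real.exp (2 * R) :=
        Real.exp_le_exp.2 (by linarith [hs.1])
      have := mul_le_mul_of_nonneg_left hexp (sq_nonneg lam)
      have h3 : 0 ≤ lam ^ 2 * Real.exp (-(2 * s)) := by positivity
      have h4 : (0 : ℝ) ≤ (α : ℝ) ^ 2 := by positivity
      rw [abs_le]
      constructor <;> simp only [Q] <;> linarith
    rw [Prod.dist_eq, Prod.dist_eq, max_le_iff]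
    constructor
    · simp only [V]
      refine (le_max_right (dist p.1 p'.1) _).trans (le_mul_of_one_le_left (by positivity)
        (le_max_left _ _))
    · simp only [V]
      rw [Real.dist_eq, ← mul_sub, abs_mul, ← Real.dist_eq]
      exact mul_le_mul (hq.trans (le_max_right _ _)) (le_max_left _ _) (by positivity)
        (by positivity)
  have hτ : τ ∈ Ioo (-R) R := by
    constructor <;> simp only [R]
    · linarith [neg_abs_le τ]
    · linarith [le_abs_self τ]
  have key := ODE_solution_unique_of_mem_Ioo (v := V) (s := fun _ => univ)
    (f := fun s => (u s, u' s)) (g := fun _ => (0, 0)) (t₀ := 0) hV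
    (by constructor <;> simp only [R] <;> linarith [abs_nonneg τ])
    (fun t _ => ⟨(h1 t).prodMk (h2 t), mem_univ _⟩)
    (fun t _ => ⟨by simpa [V] using! hasDerivAt_const t ((0 : ℝ), (0 : ℝ)), mem_univ _⟩)
    (by simp [h0, h0'])
  exact congrArg Prod.fst (key hτ)

end SolvesBessel

/-- Coefficients of `J_α`. -/
noncomputable def besselCoeff (α k : ℕ) : ℝ :=
  (-1) ^ k / ((Nat.factorial k : ℝ) * (Nat.factorial (k + α) : ℝ))

/-- Coefficients of the harmonic series in `Y_α`. -/
noncomputable def harmonicCoeff (α k : ℕ) : ℝ :=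
  (harmonicSum k + harmonicSum (k + α)) * besselCoeff α k

/-- Coefficients of the finite sum in `Y_α`. -/
noncomputable def polarCoeff (α k : ℕ) : ℝ :=
  if k < α then (Nat.factorial (α - k - 1) : ℝ) / (Nat.factorial k : ℝ) else 0

lemma entireCoeff_besselCoeff (α : ℕ) : EntireCoeff (besselCoeff α) := by
  refine ⟨1, 1, zero_le_one, zero_le_one, fun k => ?_⟩
  rw [besselCoeff, abs_div, abs_pow, abs_neg, abs_one, one_pow, mul_one,
    abs_of_nonneg (by positivity)]
  refine one_div_le_one_div_of_le (by positivity) (le_mul_of_one_le_right (by positivity) ?_)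
  exact_mod_cast Nat.one_le_iff_ne_zero.2 (Nat.factorial_ne_zero _)

lemma harmonicSum_nonneg (k : ℕ) : 0 ≤ harmonicSum k :=
  Finset.sum_nonneg fun i _ => by positivity

lemma harmonicSum_le (k : ℕ) : harmonicSum k ≤ k := by
  calc harmonicSum k ≤ ∑ i ∈ Finset.range k, (1 : ℝ) :=
        Finset.sum_le_sum fun i _ => by
          rw [div_le_one (by positivity)]
          linarith [(Nat.cast_nonneg i : (0 : ℝ) ≤ i)]
    _ = k := by simp

lemma harmonicSum_succ (k : ℕ) : harmonicSum (k + 1) = harmonicSum k + 1 / (k + 1) :=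
  Finset.sum_range_succ _ _

lemma entireCoeff_harmonicCoeff (α : ℕ) : EntireCoeff (harmonicCoeff α) := by
  refine (entireCoeff_besselCoeff α).of_le_two_pow (K := 2 + α) (by positivity) fun k => ?_
  rw [harmonicCoeff, abs_mul, abs_of_nonneg (add_nonneg (harmonicSum_nonneg _)
    (harmonicSum_nonneg _))]
  refine mul_le_mul_of_nonneg_right ?_ (abs_nonneg _)
  have h1 := harmonicSum_le k
  have h2 := harmonicSum_le (k + α)
  have h3 : (k : ℝ) ≤ 2 ^ k := by exact_mod_cast (Nat.lt_two_pow_self).le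
  have h4 : (1 : ℝ) ≤ 2 ^ k := one_le_pow₀ (by norm_num)
  push_cast at h2
  nlinarith [(Nat.cast_nonneg α : (0 : ℝ) ≤ α)]

lemma entireCoeff_polarCoeff (α : ℕ) : EntireCoeff (polarCoeff α) :=
  EntireCoeff.of_finite (n := α) fun k hk => by simp [polarCoeff, not_lt.2 hk]

lemma besselCoeff_succ (α k : ℕ) :
    ((k : ℝ) + 1) * (k + 1 + α) * besselCoeff α (k + 1) = -besselCoeff α k := by
  rw [besselCoeff, besselCoeff, show k + 1 + α = (k + α) + 1 by ring, Nat.factorial_succ,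
    Nat.factorial_succ]
  push_cast
  have : (k : ℝ) + α + 1 ≠ 0 := by positivity
  field_simp
  ring

section Series

variable (α : ℕ) {lam : ℝ} (hlam : 0 < lam) (τ : ℝ)

lemma exp_neg_nat_mul (n : ℕ) (τ : ℝ) : Real.exp (-(n * τ)) = Real.exp (-τ) ^ n := by
  rw [← Real.exp_nat_mul]
  ring_nf

lemma exp_neg_two_mul (τ : ℝ) : Real.exp (-(2 * τ)) = Real.exp (-τ) ^ 2 := by
  simpa using exp_neg_nat_mul 2 τ

lemma exp_neg_neg_nat_mul (n : ℕ) (τ : ℝ) : Real.exp (-(-(n : ℝ) * τ)) = (Real.exp (-τ) ^ n)⁻¹ := by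
  rw [neg_mul, Real.exp_neg, exp_neg_nat_mul]

lemma besselJ_eq_frobeniusSeries (lam : ℝ) :
    besselJ α (lam * Real.exp (-τ))
      = (lam / 2) ^ α * frobeniusSeries α (lam ^ 2 / 4) (besselCoeff α) τ := by
  rw [frobeniusSeries, powSer, exp_neg_nat_mul, exp_neg_two_mul, besselJ, ← mul_assoc,
    ← tsum_mul_left]
  refine tsum_congr fun k => ?_
  rw [besselCoeff, pow_add, pow_mul]
  rw [show lam * Real.exp (-τ) / 2 = lam / 2 * Real.exp (-τ) by ring, mul_pow _ _ α, mul_pow _ _ 2]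
  ring

include hlam in
lemma besselY_eq_frobeniusSeries :
    besselY α (lam * Real.exp (-τ))
      = (1 / Real.pi) * (2 * (Real.log (lam / 2) + Real.eulerMascheroniConstant - τ)
          * ((lam / 2) ^ α * frobeniusSeries α (lam ^ 2 / 4) (besselCoeff α) τ)
        - ((lam / 2) ^ α)⁻¹ * frobeniusSeries (-α) (lam ^ 2 / 4) (polarCoeff α) τ
        - (lam / 2) ^ α * frobeniusSeries α (lam ^ 2 / 4) (harmonicCoeff α) τ) := by
  have hl : Real.log (lam * Real.exp (-τ) / 2) = Real.log (lam / 2) - τ := by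
    rw [show lam * Real.exp (-τ) / 2 = lam / 2 * Real.exp (-τ) by ring,
      Real.log_mul (by positivity) (by positivity), Real.log_exp]
    ring
  have hx : lam * Real.exp (-τ) / 2 ≠ 0 := by positivity
  have hp : ∑ k ∈ Finset.range α, ((Nat.factorial (α - k - 1) : ℝ) / (Nat.factorial k : ℝ)) *
        (lam * Real.exp (-τ) / 2) ^ (2 * (k : ℤ) - (α : ℤ))
      = ((lam / 2) ^ α)⁻¹ * frobeniusSeries (-α) (lam ^ 2 / 4) (polarCoeff α) τ := by
    rw [frobeniusSeries, powSer, exp_neg_two_mul,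
      tsum_eq_sum (s := Finset.range α) (fun k hk => by
        rw [Finset.mem_range] at hk; simp [polarCoeff, hk]), Finset.mul_sum, Finset.mul_sum]
    refine Finset.sum_congr rfl fun k hk => ?_
    rw [polarCoeff, if_pos (Finset.mem_range.1 hk), zpow_sub₀ hx, zpow_mul, zpow_natCast,
      zpow_natCast, exp_neg_neg_nat_mul]
    rw [show lam * Real.exp (-τ) / 2 = lam / 2 * Real.exp (-τ) by ring, mul_pow _ _ α]
    rw [show (lam / 2 * Real.exp (-τ)) ^ (2 : ℤ) = lam ^ 2 / 4 * Real.exp (-τ) ^ 2 by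
      rw [zpow_ofNat]; ring]
    rw [div_eq_mul_inv (_ ^ k), mul_inv]
    ring
  have hh : ∑' k : ℕ, (-1 : ℝ) ^ k * (harmonicSum k + harmonicSum (k + α)) /
        ((Nat.factorial k : ℝ) * (Nat.factorial (k + α) : ℝ)) *
          (lam * Real.exp (-τ) / 2) ^ (2 * k + α)
      = (lam / 2) ^ α * frobeniusSeries α (lam ^ 2 / 4) (harmonicCoeff α) τ := by
    rw [frobeniusSeries, powSer, exp_neg_nat_mul, exp_neg_two_mul, ← mul_assoc, ← tsum_mul_left]
    refine tsum_congr fun k => ?_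
    rw [harmonicCoeff, besselCoeff, pow_add, pow_mul]
    rw [show lam * Real.exp (-τ) / 2 = lam / 2 * Real.exp (-τ) by ring, mul_pow _ _ α,
      mul_pow _ _ 2]
    ring
  rw [besselY, hl, hp, hh, besselJ_eq_frobeniusSeries]
  ring

lemma solvesBessel_besselJ (lam : ℝ) :
    SolvesBessel α lam fun τ => besselJ α (lam * Real.exp (-τ)) := by
  simp_rw [besselJ_eq_frobeniusSeries]
  have hc := entireCoeff_besselCoeff α
  refine SolvesBessel.const_mul ⟨_, fun τ => hasDerivAt_frobeniusSeries hc _ _ τ, fun τ =>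
    (hasDerivAt_frobeniusSeries (hc.affine_mul _ _) _ _ τ).congr_deriv ?_⟩ _
  rw [frobeniusSeries_second_deriv (r := fun _ => 0) hc (EntireCoeff.of_finite (n := 0) (by simp))
    _ _ _ rfl (fun k => ?_)]
  · have h0 : frobeniusSeries α (lam ^ 2 / 4) (fun _ => 0) τ = 0 := by
      simp [frobeniusSeries, powSer]
    rw [h0]
    ring
  · linear_combination 4 * besselCoeff_succ α k

lemma solvesBessel_besselY {lam : ℝ} (hlam : 0 < lam) :
    SolvesBessel α lam fun τ => besselY α (lam * Real.exp (-τ)) := by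
  simp_rw [besselY_eq_frobeniusSeries α hlam]
  refine SolvesBessel.const_mul ?_ _
  set q := lam ^ 2 / 4
  set a := (lam / 2) ^ α with ha
  have ha0 : a ≠ 0 := by positivity
  have hc := entireCoeff_besselCoeff α
  have hb := entireCoeff_polarCoeff α
  have hd := entireCoeff_harmonicCoeff α
  set L := Real.log (lam / 2) + Real.eulerMascheroniConstant
  have hL : ∀ τ, HasDerivAt (fun τ => 2 * (L - τ)) (-2) τ := fun τ =>
    (((hasDerivAt_id τ).const_sub L).const_mul 2).congr_deriv (by norm_num)
  have hJ1 := fun τ => hasDerivAt_frobeniusSeries hc α q τ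
  have hJ2 := fun τ => hasDerivAt_frobeniusSeries (hc.affine_mul (-2) (-α)) α q τ
  have hP1 := fun τ => hasDerivAt_frobeniusSeries hb (-α) q τ
  have hP2 := fun τ => hasDerivAt_frobeniusSeries (hb.affine_mul (-2) (-(-α))) (-α) q τ
  have hH1 := fun τ => hasDerivAt_frobeniusSeries hd α q τ
  have hH2 := fun τ => hasDerivAt_frobeniusSeries (hd.affine_mul (-2) (-α)) α q τ
  refine ⟨fun τ => -2 * (a * frobeniusSeries α q (besselCoeff α) τ)
      + 2 * (L - τ) * (a * frobeniusSeries α q _ τ) - a⁻¹ * frobeniusSeries (-α) q _ τ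
      - a * frobeniusSeries α q _ τ,
    fun τ => (((hL τ).mul ((hJ1 τ).const_mul a)).sub ((hP1 τ).const_mul a⁻¹)).sub
      ((hH1 τ).const_mul a), fun τ =>
    ((((((hJ1 τ).const_mul a).const_mul (-2)).add ((hL τ).mul ((hJ2 τ).const_mul a))).sub
      ((hP2 τ).const_mul a⁻¹)).sub ((hH2 τ).const_mul a)).congr_deriv ?_⟩
  have hJ := frobeniusSeries_second_deriv (r := fun _ => 0) hc
    (EntireCoeff.of_finite (n := 0) (by simp)) α q τ rfl
    (fun k => by linear_combination 4 * besselCoeff_succ α k)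
  have hP := frobeniusSeries_second_deriv (r := fun k => if k = α then 4 * α / α.factorial else 0)
    hb (EntireCoeff.of_finite (n := α + 1) (fun k hk => if_neg (by omega))) (-α) q τ
    (by
      rcases Nat.eq_zero_or_pos α with h | h
      · simp [h]
      · exact if_neg h.ne)
    (fun k => by
      rcases lt_trichotomy (k + 1) α with h | h | h
      · rw [if_neg h.ne, polarCoeff, polarCoeff, if_pos h, if_pos (by omega)]
        obtain ⟨j, rfl⟩ := Nat.exists_eq_add_of_lt h
        rw [show k + 1 + j + 1 - (k + 1) - 1 = j by omega,
          show k + 1 + j + 1 - k - 1 = j + 1 by omega, Nat.factorial_succ, Nat.factorial_succ]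
        push_cast
        field_simp
        ring
      · rw [if_pos h, polarCoeff, polarCoeff, if_neg (by omega), if_pos (by omega)]
        subst h
        rw [show k + 1 - k - 1 = 0 by omega, Nat.factorial_succ]
        push_cast
        field_simp
        simp
      · rw [if_neg h.ne', polarCoeff, polarCoeff, if_neg (by omega), if_neg (by omega)]
        simp)
  have hr : EntireCoeff fun k : ℕ => if k = 0 then 0 else (8 * (k : ℝ) + 4 * α) * besselCoeff α k :=
    (hc.affine_mul 8 (4 * α)).of_le_two_pow (K := 1) zero_le_one fun k => by
      have h2 : (1 : ℝ) ≤ 2 ^ k := one_le_pow₀ (by norm_num)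
      rw [one_mul]
      refine le_trans ?_ (le_mul_of_one_le_left (abs_nonneg _) h2)
      split_ifs
      · rw [abs_zero]
        exact abs_nonneg _
      · exact le_rfl
  have hH := frobeniusSeries_second_deriv hd hr α q τ (by simp)
    (fun k => by
      rw [if_neg (by omega), harmonicCoeff, harmonicCoeff, harmonicSum_succ,
        show k + 1 + α = (k + α) + 1 by ring, harmonicSum_succ]
      have h1 := besselCoeff_succ α k
      have e : ((k : ℝ) + 1) * (k + 1 + α) * (1 / (k + 1) + 1 / (k + α + 1)) = 2 * k + 2 + α := by
        have : (k : ℝ) + α + 1 ≠ 0 := by positivity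
        field_simp
        ring
      push_cast
      linear_combination 4 * (harmonicSum k + harmonicSum (k + α)) * h1
        + 4 * besselCoeff α (k + 1) * e)
  have hpolar : frobeniusSeries (-α) q (fun k => if k = α then 4 * α / α.factorial else 0) τ
      = a ^ 2 * (Real.exp (-τ) ^ α * (4 * α / α.factorial)) := by
    rw [frobeniusSeries, powSer, tsum_eq_single α (fun k hk => by simp [hk]), if_pos rfl,
      exp_neg_neg_nat_mul, exp_neg_two_mul, mul_pow]
    have : q ^ α = a ^ 2 := by
      rw [ha, ← pow_mul, mul_comm, pow_mul]
      congr 1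
      simp only [q]
      ring
    rw [this]
    have : Real.exp (-τ) ^ α ≠ 0 := by positivity
    rw [← pow_mul (Real.exp (-τ)), mul_comm 2 α, pow_mul (Real.exp (-τ))]
    field_simp
  have hharm : frobeniusSeries α q
        (fun k : ℕ => if k = 0 then 0 else (8 * (k : ℝ) + 4 * α) * besselCoeff α k) τ
      = -4 * frobeniusSeries α q (fun k => ((-2) * k + (-α)) * besselCoeff α k) τ
        - Real.exp (-τ) ^ α * (4 * α / α.factorial) := by
    rw [frobeniusSeries, frobeniusSeries, exp_neg_nat_mul]
    set z := q * Real.exp (-(2 * τ))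
    have h1 := (hr.summable z).tsum_eq_zero_add
    have h2 := ((hc.affine_mul (-2) (-α)).summable z).tsum_eq_zero_add
    have h3 : powSer (fun k : ℕ => if k = 0 then 0 else (8 * (k : ℝ) + 4 * α) * besselCoeff α k) z
        = -4 * powSer (fun k => ((-2) * k + (-α)) * besselCoeff α k) z
          - 4 * α / α.factorial := by
      rw [powSer, powSer, h1, h2, mul_add, ← tsum_mul_left]
      have h4 : besselCoeff α 0 = 1 / α.factorial := by simp [besselCoeff]
      rw [h4]
      have h5 : ∀ k : ℕ, (if k + 1 = 0 then 0
          else (8 * ((k + 1 : ℕ) : ℝ) + 4 * α) * besselCoeff α (k + 1)) * z ^ (k + 1)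
          = -4 * (((-2) * ((k + 1 : ℕ) : ℝ) + (-α)) * besselCoeff α (k + 1) * z ^ (k + 1)) := by
        intro k
        rw [if_neg (by omega)]
        ring
      rw [tsum_congr h5]
      simp
      ring
    rw [h3]
    ring
  have h0 : frobeniusSeries α q (fun _ => 0) τ = 0 := by simp [frobeniusSeries, powSer]
  rw [hpolar] at hP
  rw [hharm] at hH
  rw [h0] at hJ
  rw [hJ, hP, hH]
  simp only [q]
  field_simp
  ring

end Series

/-- The squared distance `1 + t ^ 2 - 2 * t * cosh η` at `t = exp (-τ)`. -/
noncomputable def expGap (τ η : ℝ) : ℝ :=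
  1 + Real.exp (-τ) ^ 2 - 2 * Real.exp (-τ) * Real.cosh η

lemma expGap_self (τ : ℝ) : expGap τ τ = 0 := by
  rw [expGap, Real.cosh_eq]
  have : Real.exp (-τ) * Real.exp τ = 1 := by rw [← Real.exp_add]; simp
  linear_combination -this

lemma hasDerivAt_exp_neg (τ : ℝ) : HasDerivAt (fun τ => Real.exp (-τ)) (-Real.exp (-τ)) τ := by
  simpa using (hasDerivAt_neg τ).exp

lemma hasDerivAt_expGap (τ η : ℝ) : HasDerivAt (fun τ => expGap τ η)
    (-2 * Real.exp (-τ) ^ 2 + 2 * Real.exp (-τ) * Real.cosh η) τ := by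
  refine ((((hasDerivAt_exp_neg τ).pow 2).const_add 1).sub
    (((hasDerivAt_exp_neg τ).const_mul 2).mul_const (Real.cosh η))).congr_deriv ?_
  push_cast
  ring

lemma hasDerivAt_expGap_deriv (τ η : ℝ) :
    HasDerivAt (fun τ => -2 * Real.exp (-τ) ^ 2 + 2 * Real.exp (-τ) * Real.cosh η)
      (4 * Real.exp (-τ) ^ 2 - 2 * Real.exp (-τ) * Real.cosh η) τ := by
  refine ((((hasDerivAt_exp_neg τ).pow 2).const_mul (-2)).add
    (((hasDerivAt_exp_neg τ).const_mul 2).mul_const (Real.cosh η))).congr_deriv ?_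
  push_cast
  ring

lemma hasDerivAt_expGap_right (τ η : ℝ) :
    HasDerivAt (expGap τ) (-2 * Real.exp (-τ) * Real.sinh η) η := by
  refine (((Real.hasDerivAt_cosh η).const_mul (2 * Real.exp (-τ))).const_sub
    (1 + Real.exp (-τ) ^ 2)).congr_deriv ?_
  ring

lemma hasDerivAt_expGap_right_deriv (τ η : ℝ) :
    HasDerivAt (fun η => -2 * Real.exp (-τ) * Real.sinh η)
      (-2 * Real.exp (-τ) * Real.cosh η) η :=
  (Real.hasDerivAt_sinh η).const_mul _

lemma continuous_expGap : Continuous fun p : ℝ × ℝ => expGap p.1 p.2 := by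
  unfold expGap
  fun_prop

/-- Riemann's integral against the kernel `φ`; it solves Bessel's equation when `φ` satisfies
`x φ'' + φ' = -(lam ^ 2 / 4) φ`. -/
noncomputable def riemannIntegral (φ : ℝ → ℝ) (α : ℕ) (τ : ℝ) : ℝ :=
  ∫ η in (0 : ℝ)..τ, φ (expGap τ η) * Real.cosh (α * η)

section RiemannIntegral

variable {φ φ₁ φ₂ : ℝ → ℝ} {lam : ℝ} (h1 : ∀ x, HasDerivAt φ (φ₁ x) x)
  (h2 : ∀ x, HasDerivAt φ₁ (φ₂ x) x) (hc : Continuous φ₂)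

include h1 h2 in
lemma hasDerivAt_riemannIntegral (α : ℕ) (τ : ℝ) :
    HasDerivAt (riemannIntegral φ α) (φ 0 * Real.cosh (α * τ) + ∫ η in (0 : ℝ)..τ,
      φ₁ (expGap τ η) * (-2 * Real.exp (-τ) ^ 2 + 2 * Real.exp (-τ) * Real.cosh η)
        * Real.cosh (α * η)) τ := by
  have c0 : Continuous φ := continuous_iff_continuousAt.2 fun x => (h1 x).continuousAt
  have c1 : Continuous φ₁ := continuous_iff_continuousAt.2 fun x => (h2 x).continuousAt
  have cX := continuous_expGap
  have := hasDerivAt_integral_zero_self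
    (f := fun τ η => φ (expGap τ η) * Real.cosh (α * η))
    (f' := fun τ η => φ₁ (expGap τ η)
      * (-2 * Real.exp (-τ) ^ 2 + 2 * Real.exp (-τ) * Real.cosh η) * Real.cosh (α * η))
    ((c0.comp cX).mul (by fun_prop)) (((c1.comp cX).mul (by fun_prop)).mul (by fun_prop))
    (fun a η => ((h1 _).comp a (hasDerivAt_expGap a η)).mul_const _) τ
  simpa only [expGap_self] using! this

include h1 h2 hc in
lemma hasDerivAt_riemannIntegral_deriv
    (hode : ∀ x, x * φ₂ x + φ₁ x = -(lam ^ 2 / 4) * φ x) (α : ℕ) (τ : ℝ) :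
    HasDerivAt (fun τ => φ 0 * Real.cosh (α * τ) + ∫ η in (0 : ℝ)..τ,
      φ₁ (expGap τ η) * (-2 * Real.exp (-τ) ^ 2 + 2 * Real.exp (-τ) * Real.cosh η)
        * Real.cosh (α * η))
      ((α ^ 2 - lam ^ 2 * Real.exp (-(2 * τ))) * riemannIntegral φ α τ) τ := by
  have c0 : Continuous φ := continuous_iff_continuousAt.2 fun x => (h1 x).continuousAt
  have c1 : Continuous φ₁ := continuous_iff_continuousAt.2 fun x => (h2 x).continuousAt
  have cX := continuous_expGap
  have cXr : Continuous (expGap τ) := cX.comp (Continuous.prodMk_right τ)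
  have hcosh : ∀ x, HasDerivAt (fun x : ℝ => Real.cosh (α * x)) (α * Real.sinh (α * x)) x :=
    fun x => (((hasDerivAt_id x).const_mul (α : ℝ)).cosh).congr_deriv (by simp; ring)
  have hsinh : ∀ x, HasDerivAt (fun x : ℝ => Real.sinh (α * x)) (α * Real.cosh (α * x)) x :=
    fun x => (((hasDerivAt_id x).const_mul (α : ℝ)).sinh).congr_deriv (by simp; ring)
  have hl := hasDerivAt_integral_zero_self
    (f := fun τ η => φ₁ (expGap τ η)
      * (-2 * Real.exp (-τ) ^ 2 + 2 * Real.exp (-τ) * Real.cosh η) * Real.cosh (α * η))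
    (f' := fun τ η => (φ₂ (expGap τ η)
        * (-2 * Real.exp (-τ) ^ 2 + 2 * Real.exp (-τ) * Real.cosh η)
        * (-2 * Real.exp (-τ) ^ 2 + 2 * Real.exp (-τ) * Real.cosh η)
      + φ₁ (expGap τ η) * (4 * Real.exp (-τ) ^ 2 - 2 * Real.exp (-τ) * Real.cosh η))
        * Real.cosh (α * η))
    (((c1.comp cX).mul (by fun_prop)).mul (by fun_prop))
    (((((hc.comp cX).mul (by fun_prop)).mul (by fun_prop)).add
      ((c1.comp cX).mul (by fun_prop))).mul (by fun_prop))
    (fun a η => (((h2 _).comp a (hasDerivAt_expGap a η)).mul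
      (hasDerivAt_expGap_deriv a η)).mul_const _) τ
  refine (((hcosh τ).const_mul (φ 0)).add hl).congr_deriv ?_
  -- integration by parts in the spatial variable
  have hparts : ∀ η ∈ uIcc 0 τ, HasDerivAt
      (fun η => φ₁ (expGap τ η) * (-2 * Real.exp (-τ) * Real.sinh η) * Real.cosh (α * η)
        - α * (φ (expGap τ η) * Real.sinh (α * η)))
      ((φ₂ (expGap τ η)
        * (-2 * Real.exp (-τ) ^ 2 + 2 * Real.exp (-τ) * Real.cosh η)
        * (-2 * Real.exp (-τ) ^ 2 + 2 * Real.exp (-τ) * Real.cosh η)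
      + φ₁ (expGap τ η) * (4 * Real.exp (-τ) ^ 2 - 2 * Real.exp (-τ) * Real.cosh η))
        * Real.cosh (α * η)
        - (α ^ 2 - lam ^ 2 * Real.exp (-(2 * τ))) * (φ (expGap τ η) * Real.cosh (α * η))) η := by
    intro η _
    have hX := hasDerivAt_expGap_right τ η
    refine (((((h2 _).comp η hX).mul (hasDerivAt_expGap_right_deriv τ η)).mul (hcosh η)).sub
      ((((h1 _).comp η hX).mul (hsinh η)).const_mul _)).congr_deriv ?_
    have ho := hode (expGap τ η)
    have hs := Real.cosh_sq η
    rw [exp_neg_two_mul]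
    simp only [Function.comp, Pi.mul_apply]
    set E := Real.exp (-τ)
    have e : expGap τ η = 1 + E ^ 2 - 2 * E * Real.cosh η := rfl
    linear_combination (-4 * E ^ 2 * Real.cosh (α * η)) * ho
      + 4 * E ^ 2 * Real.cosh (α * η) * φ₂ (expGap τ η) * e
      - 4 * E ^ 2 * Real.cosh (α * η) * φ₂ (expGap τ η) * hs
  have hI1 : IntervalIntegrable (fun η => (φ₂ (expGap τ η)
        * (-2 * Real.exp (-τ) ^ 2 + 2 * Real.exp (-τ) * Real.cosh η)
        * (-2 * Real.exp (-τ) ^ 2 + 2 * Real.exp (-τ) * Real.cosh η)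
      + φ₁ (expGap τ η) * (4 * Real.exp (-τ) ^ 2 - 2 * Real.exp (-τ) * Real.cosh η))
        * Real.cosh (α * η)) volume 0 τ := by
    apply Continuous.intervalIntegrable
    fun_prop
  have hI2 : IntervalIntegrable (fun η => (α ^ 2 - lam ^ 2 * Real.exp (-(2 * τ)))
      * (φ (expGap τ η) * Real.cosh (α * η))) volume 0 τ := by
    apply Continuous.intervalIntegrable
    fun_prop
  have hint := intervalIntegral.integral_eq_sub_of_hasDerivAt hparts (hI1.sub hI2)
  rw [intervalIntegral.integral_sub hI1 hI2, intervalIntegral.integral_const_mul] at hint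
  rw [riemannIntegral]
  simp only [expGap_self, mul_zero, Real.sinh_zero, zero_mul, sub_zero] at hint ⊢
  have hcs := Real.cosh_sub_sinh τ
  linear_combination hint + 2 * φ₁ 0 * Real.exp (-τ) * Real.cosh (α * τ) * hcs

include h1 h2 hc in
/-- A solution of Bessel's equation vanishing at `τ = 0` is a multiple of Riemann's integral. -/
lemma SolvesBessel.exists_eq_mul_riemannIntegral {α : ℕ} {u : ℝ → ℝ} (hu : SolvesBessel α lam u)
    (hu0 : u 0 = 0) (hφ : φ 0 = 1) (hode : ∀ x, x * φ₂ x + φ₁ x = -(lam ^ 2 / 4) * φ x) :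
    ∃ c : ℝ, ∀ τ, u τ = c * riemannIntegral φ α τ := by
  obtain ⟨u', hu1, hu2⟩ := hu
  refine ⟨u' 0, fun τ => ?_⟩
  have := SolvesBessel.eq_zero (α := α) (lam := lam)
    (fun τ => (hu1 τ).sub ((hasDerivAt_riemannIntegral h1 h2 α τ).const_mul (u' 0)))
    (fun τ => ((hu2 τ).sub
      ((hasDerivAt_riemannIntegral_deriv h1 h2 hc hode α τ).const_mul (u' 0))).congr_deriv (by
        simp only [Pi.sub_apply]
        ring))
    (by simp [riemannIntegral, hu0]) (by simp [hφ]) τ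
  exact sub_eq_zero.1 this

end RiemannIntegral

/-- Coefficients of `x ↦ J_0 (lam * √x)`. -/
noncomputable def riemannCoeff (lam : ℝ) (k : ℕ) : ℝ :=
  (-(lam ^ 2 / 4)) ^ k / (Nat.factorial k : ℝ) ^ 2

lemma entireCoeff_riemannCoeff (lam : ℝ) : EntireCoeff (riemannCoeff lam) := by
  refine ⟨1, lam ^ 2 / 4, zero_le_one, by positivity, fun k => ?_⟩
  rw [riemannCoeff, abs_div, abs_pow, abs_neg, abs_of_nonneg (by positivity : 0 ≤ lam ^ 2 / 4),
    abs_of_nonneg (by positivity), one_mul]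
  refine div_le_div_of_nonneg_left (by positivity) (by positivity) ?_
  exact le_self_pow₀ (by exact_mod_cast Nat.one_le_iff_ne_zero.2 (Nat.factorial_ne_zero k))
    two_ne_zero

lemma riemannCoeff_succ (lam : ℝ) (k : ℕ) :
    (k + 1) ^ 2 * riemannCoeff lam (k + 1) = -(lam ^ 2 / 4) * riemannCoeff lam k := by
  rw [riemannCoeff, riemannCoeff, Nat.factorial_succ]
  push_cast
  field_simp
  ring

lemma powSer_riemannCoeff_ode (lam x : ℝ) :
    x * powSer (fun k => ((k : ℝ) + 1) * (((k + 1 : ℕ) + 1) * riemannCoeff lam (k + 1 + 1))) x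
        + powSer (fun k => ((k : ℝ) + 1) * riemannCoeff lam (k + 1)) x
      = -(lam ^ 2 / 4) * powSer (riemannCoeff lam) x := by
  have hc := (entireCoeff_riemannCoeff lam).shift
  rw [hc.mul_powSer_shift, powSer, powSer, powSer, ← tsum_mul_left]
  rw [← Summable.tsum_add (by simpa using (hc.affine_mul 1 0).summable x) (hc.summable x)]
  refine tsum_congr fun k => ?_
  linear_combination x ^ k * riemannCoeff_succ lam k

lemma powSer_riemannCoeff_zero (lam : ℝ) : powSer (riemannCoeff lam) 0 = 1 := by
  rw [powSer, tsum_eq_single 0 (fun k hk => by simp [hk])]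
  simp [riemannCoeff]

/-- The truncated power `y ↦ y₊ ^ m`, with `0₊ ^ 0 = 0`. -/
noncomputable def truncPow (m : ℕ) (y : ℝ) : ℝ := if 0 < y then y ^ m else 0

lemma truncPow_succ (m : ℕ) (y : ℝ) : truncPow (m + 1) y = max y 0 ^ (m + 1) := by
  rw [truncPow]
  split_ifs with h
  · rw [max_eq_left h.le]
  · rw [max_eq_right (not_lt.1 h), zero_pow (Nat.succ_ne_zero m)]

lemma measurable_truncPow (m : ℕ) : Measurable (truncPow m) :=
  Measurable.ite measurableSet_Ioi (by fun_prop) measurable_const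

lemma abs_truncPow_le (m : ℕ) {y : ℝ} (hy : y ≤ 1) : |truncPow m y| ≤ 1 := by
  rw [truncPow]
  split_ifs with h
  · rw [abs_of_nonneg (by positivity)]
    exact pow_le_one₀ h.le hy
  · simp

lemma abs_truncPow_succ_sub_le (m : ℕ) {x y : ℝ} (hx : x ≤ 1) (hy : y ≤ 1) :
    |truncPow (m + 1) x - truncPow (m + 1) y| ≤ (m + 1) * |x - y| := by
  rw [truncPow_succ, truncPow_succ]
  refine (abs_pow_sub_pow_le _ _ _).trans ?_
  have h1 : |max x 0 - max y 0| ≤ |x - y| := abs_max_sub_max_le_abs x y 0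
  have h2 : max |max x 0| |max y 0| ^ (m + 1 - 1) ≤ 1 := by
    refine pow_le_one₀ (by positivity) (max_le ?_ ?_) <;>
      rw [abs_of_nonneg (le_max_right _ _)] <;> exact max_le (by assumption) zero_le_one
  calc |max x 0 - max y 0| * ((m + 1 : ℕ) : ℝ) * max |max x 0| |max y 0| ^ (m + 1 - 1)
      ≤ |x - y| * ((m + 1 : ℕ) : ℝ) * 1 := by gcongr
    _ = (m + 1) * |x - y| := by
      push_cast
      ring

lemma tendsto_truncPow_slope (m : ℕ) (y : ℝ) :
    Tendsto (fun δ => (truncPow (m + 1) y - truncPow (m + 1) (y - δ)) / δ) (𝓝[>] 0)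
      (𝓝 ((m + 1) * truncPow m y)) := by
  by_cases hy : 0 < y
  · have hd : HasDerivAt (fun δ : ℝ => -(y - δ) ^ (m + 1)) ((m + 1) * y ^ m) 0 := by
      refine ((((hasDerivAt_id (0 : ℝ)).const_sub y).pow (m + 1)).neg).congr_deriv ?_
      simp
    have ht := (hasDerivAt_iff_tendsto_slope_zero.1 hd).mono_left
      (nhdsWithin_mono (0 : ℝ) (fun x (hx : 0 < x) => hx.ne'))
    rw [show truncPow m y = y ^ m from if_pos hy]
    refine ht.congr' ?_
    have : Ioo (0 : ℝ) y ∈ 𝓝[>] 0 := Ioo_mem_nhdsGT hy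
    filter_upwards [this] with δ hδ
    rw [truncPow, truncPow, if_pos hy, if_pos (by linarith [hδ.2])]
    simp
    ring
  · rw [truncPow, truncPow, if_neg hy, if_neg hy, mul_zero]
    refine tendsto_const_nhds.congr' ?_
    filter_upwards [self_mem_nhdsWithin] with δ hδ
    have hδ : 0 < δ := hδ
    rw [truncPow, if_neg (by linarith)]
    simp

section Layers

variable {Ω : Type*} [MeasurableSpace Ω] {μ : Measure Ω} {g X : Ω → ℝ}

lemma integrable_mul_truncPow (hg : Integrable g μ) (hX : Measurable X)
    (hX1 : ∀ᵐ ω ∂μ, X ω < 1) (m : ℕ) {v : ℝ} (hv : 0 ≤ v) :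
    Integrable (fun ω => g ω * truncPow m (X ω - v)) μ := by
  refine hg.mul_bdd (c := 1)
    ((measurable_truncPow m).comp (hX.sub_const v)).aestronglyMeasurable ?_
  filter_upwards [hX1] with ω h
  exact abs_truncPow_le m (by linarith)

lemma integral_truncPow_eq_zero_of_succ (hg : Integrable g μ) (hX : Measurable X)
    (hX1 : ∀ᵐ ω ∂μ, X ω < 1) {m : ℕ}
    (h : ∀ v ∈ Ioo (0 : ℝ) 1, ∫ ω, g ω * truncPow (m + 1) (X ω - v) ∂μ = 0) :
    ∀ v ∈ Ioo (0 : ℝ) 1, ∫ ω, g ω * truncPow m (X ω - v) ∂μ = 0 := by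
  intro v hv
  have hδ : ∀ᶠ δ in 𝓝[>] (0 : ℝ), 0 < δ ∧ δ < 1 - v := by
    filter_upwards [Ioo_mem_nhdsGT (sub_pos.2 hv.2)] with δ hδ using hδ
  have key : Tendsto (fun δ => ∫ ω, g ω *
      ((truncPow (m + 1) (X ω - v) - truncPow (m + 1) (X ω - v - δ)) / δ) ∂μ) (𝓝[>] 0)
      (𝓝 (∫ ω, g ω * ((m + 1) * truncPow m (X ω - v)) ∂μ)) := by
    refine tendsto_integral_filter_of_dominated_convergence (fun ω => |g ω| * (m + 1))
      (Eventually.of_forall fun δ => hg.aestronglyMeasurable.mul ?_) ?_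
      (hg.abs.mul_const _)
      (Eventually.of_forall fun ω => (tendsto_truncPow_slope m _).const_mul _)
    · have h1 := (measurable_truncPow (m + 1)).comp (hX.sub_const v)
      have h2 := (measurable_truncPow (m + 1)).comp ((hX.sub_const v).sub_const δ)
      exact ((h1.sub h2).div_const δ).aestronglyMeasurable
    · filter_upwards [hδ] with δ hδ
      filter_upwards [hX1] with ω hω
      rw [norm_mul, Real.norm_eq_abs, Real.norm_eq_abs, abs_div, abs_of_pos hδ.1]
      refine mul_le_mul_of_nonneg_left ?_ (abs_nonneg _)
      rw [div_le_iff₀ hδ.1]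
      refine (abs_truncPow_succ_sub_le m (by linarith [hv.1]) (by linarith [hv.1])).trans
        (le_of_eq ?_)
      rw [sub_sub_cancel, abs_of_pos hδ.1]
  have hzero : ∀ᶠ δ in 𝓝[>] (0 : ℝ), ∫ ω, g ω *
      ((truncPow (m + 1) (X ω - v) - truncPow (m + 1) (X ω - v - δ)) / δ) ∂μ = 0 := by
    filter_upwards [hδ] with δ hδ
    have e : ∀ ω, g ω * ((truncPow (m + 1) (X ω - v) - truncPow (m + 1) (X ω - v - δ)) / δ)
        = (g ω * truncPow (m + 1) (X ω - v)
          - g ω * truncPow (m + 1) (X ω - (v + δ))) / δ := fun ω => by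
      rw [sub_sub]
      ring
    simp_rw [e]
    rw [integral_div, integral_sub (integrable_mul_truncPow hg hX hX1 _ hv.1.le)
      (integrable_mul_truncPow hg hX hX1 _ (by linarith [hv.1])), h v hv,
      h (v + δ) ⟨by linarith [hv.1], by linarith⟩]
    simp
  have hlim := tendsto_nhds_unique (key.congr' hzero) tendsto_const_nhds
  have e : ∀ ω, g ω * ((m + 1) * truncPow m (X ω - v))
      = (m + 1) * (g ω * truncPow m (X ω - v)) := fun ω => by ring
  simp_rw [e] at hlim
  rw [integral_const_mul] at hlim
  exact (mul_eq_zero.1 hlim).resolve_left (by positivity)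

lemma integral_truncPow_zero_eq_zero (hg : Integrable g μ) (hX : Measurable X)
    (hX1 : ∀ᵐ ω ∂μ, X ω < 1) (m : ℕ)
    (h : ∀ v ∈ Ioo (0 : ℝ) 1, ∫ ω, g ω * truncPow m (X ω - v) ∂μ = 0) :
    ∀ v ∈ Ioo (0 : ℝ) 1, ∫ ω, g ω * truncPow 0 (X ω - v) ∂μ = 0 := by
  induction m with
  | zero => exact h
  | succ m ih => exact ih (integral_truncPow_eq_zero_of_succ hg hX hX1 h)

lemma integral_eq_zero_of_truncPow_zero (hg : Integrable g μ) (hX : Measurable X)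
    (hX0 : ∀ᵐ ω ∂μ, 0 < X ω)
    (h : ∀ v ∈ Ioo (0 : ℝ) 1, ∫ ω, g ω * truncPow 0 (X ω - v) ∂μ = 0) :
    ∫ ω, g ω ∂μ = 0 := by
  have key : Tendsto (fun v => ∫ ω, g ω * truncPow 0 (X ω - v) ∂μ) (𝓝[>] 0)
      (𝓝 (∫ ω, g ω ∂μ)) := by
    refine tendsto_integral_filter_of_dominated_convergence (fun ω => |g ω|)
      (Eventually.of_forall fun v => hg.aestronglyMeasurable.mul
        ((measurable_truncPow 0).comp (hX.sub_const v)).aestronglyMeasurable)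
      (Eventually.of_forall fun v => Eventually.of_forall fun ω => ?_) hg.abs ?_
    · rw [norm_mul, Real.norm_eq_abs, Real.norm_eq_abs]
      refine mul_le_of_le_one_right (abs_nonneg _) ?_
      rw [truncPow]
      split_ifs <;> simp
    · filter_upwards [hX0] with ω hω
      refine tendsto_const_nhds.congr' ?_
      filter_upwards [Ioo_mem_nhdsGT hω] with v hv
      rw [truncPow, if_pos (sub_pos.2 hv.2)]
      simp
  have hzero : ∀ᶠ v in 𝓝[>] (0 : ℝ), ∫ ω, g ω * truncPow 0 (X ω - v) ∂μ = 0 := by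
    filter_upwards [Ioo_mem_nhdsGT zero_lt_one] with v hv using h v hv
  exact tendsto_nhds_unique (key.congr' hzero) tendsto_const_nhds

/-- If `g` is orthogonal to the truncated powers of `X` then it is orthogonal to every `C¹`
function of `X`. -/
lemma integral_mul_comp_eq_zero [SFinite μ] (hg : Integrable g μ) (hX : Measurable X)
    (hX0 : ∀ᵐ ω ∂μ, 0 < X ω) (hX1 : ∀ᵐ ω ∂μ, X ω < 1) (m : ℕ)
    (h : ∀ v ∈ Ioo (0 : ℝ) 1, ∫ ω, g ω * truncPow m (X ω - v) ∂μ = 0)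
    {φ φ' : ℝ → ℝ} (hφ : ∀ x, HasDerivAt φ (φ' x) x) (hφ' : Continuous φ') :
    ∫ ω, g ω * φ (X ω) ∂μ = 0 := by
  have h0 := integral_truncPow_zero_eq_zero hg hX hX1 m h
  have hφi : IntegrableOn φ' (Ioo 0 1) :=
    (hφ'.integrableOn_Icc).mono_set Ioo_subset_Icc_self
  have hrepr : ∀ᵐ ω ∂μ, g ω * φ (X ω) = φ 0 * g ω
      + ∫ v in Ioo (0 : ℝ) 1, g ω * φ' v * truncPow 0 (X ω - v) := by
    filter_upwards [hX0, hX1] with ω h1 h2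
    have e : ∀ v, g ω * φ' v * truncPow 0 (X ω - v)
        = g ω * (Iio (X ω)).indicator φ' v := fun v => by
      rw [truncPow, indicator]
      simp only [mem_Iio, sub_pos, pow_zero]
      split_ifs <;> ring
    simp_rw [e]
    rw [integral_const_mul, setIntegral_indicator measurableSet_Iio,
      show Ioo (0 : ℝ) 1 ∩ Iio (X ω) = Ioo 0 (X ω) by
        rw [Ioo_inter_Iio, min_eq_right h2.le],
      ← integral_Ioc_eq_integral_Ioo, ← intervalIntegral.integral_of_le h1.le,
      intervalIntegral.integral_eq_sub_of_hasDerivAt (fun x _ => hφ x)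
        (hφ'.intervalIntegrable _ _)]
    ring
  have hprod : Integrable (fun p : Ω × ℝ => g p.1 * φ' p.2 * truncPow 0 (X p.1 - p.2))
      (μ.prod (volume.restrict (Ioo 0 1))) := by
    refine (hg.mul_prod hφi).mul_bdd (c := 1) ?_ (Eventually.of_forall fun p => ?_)
    · exact ((measurable_truncPow 0).comp
        ((hX.comp measurable_fst).sub measurable_snd)).aestronglyMeasurable
    · rw [truncPow]
      split_ifs <;> simp
  rw [integral_congr_ae hrepr, integral_add (hg.const_mul _) hprod.integral_prod_left,
    integral_const_mul, integral_eq_zero_of_truncPow_zero hg hX hX0 h0,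
    integral_integral_swap hprod, mul_zero, zero_add]
  refine setIntegral_eq_zero_of_forall_eq_zero fun v hv => ?_
  have e : ∀ ω, g ω * φ' v * truncPow 0 (X ω - v)
      = φ' v * (g ω * truncPow 0 (X ω - v)) := fun ω => by ring
  simp_rw [e]
  rw [integral_const_mul, h0 v hv, mul_zero]

end Layers

/-- The function `1 + t ^ 2 - 2 * t * cosh r` of the dual variables `t, r`. -/
noncomputable def gap (t r : ℝ) : ℝ := 1 + t ^ 2 - 2 * t * Real.cosh r

/-- The set of positive `r` with `v < gap t r`. -/
def gapSet (t v : ℝ) : Set ℝ := {r | 0 < r ∧ v < gap t r}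

lemma continuous_gap : Continuous fun p : ℝ × ℝ => gap p.1 p.2 := by
  unfold gap
  fun_prop

lemma measurableSet_gapSet (t v : ℝ) : MeasurableSet (gapSet t v) := by
  have : Continuous (gap t) := continuous_gap.comp (Continuous.prodMk_right t)
  exact measurableSet_Ioi.inter (measurableSet_lt measurable_const this.measurable)

lemma gap_eq (t r : ℝ) : gap t r = (1 - t) ^ 2 - 2 * t * (Real.cosh r - 1) := by
  rw [gap]
  ring

lemma exists_cosh_eq {x : ℝ} (hx : 1 ≤ x) : ∃ Y, 0 ≤ Y ∧ Real.cosh Y = x :=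
  ⟨Real.arcosh x, Real.arcosh_nonneg hx, Real.cosh_arcosh hx⟩

section GapSet

variable {t v Y : ℝ}

lemma gap_le (ht : 0 < t) (r : ℝ) : gap t r ≤ (1 - t) ^ 2 := by
  rw [gap_eq]
  have := mul_nonneg (mul_nonneg zero_le_two ht.le) (sub_nonneg.2 (Real.one_le_cosh r))
  linarith

lemma gapSet_eq_Ioo (ht : 0 < t) (hY : 0 ≤ Y) (h : 2 * t * Real.cosh Y = 1 + t ^ 2 - v) :
    gapSet t v = Ioo 0 Y := by
  ext r
  refine and_congr_right fun hr => ?_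
  rw [← abs_of_pos hr, ← abs_of_nonneg hY, ← Real.cosh_lt_cosh, abs_of_pos hr, gap]
  have h2 : 0 < 2 * t := by positivity
  rw [← mul_lt_mul_iff_right₀ (b := Real.cosh r) h2, h]
  constructor <;> intro h' <;> linarith

lemma gapSet_eq_empty (ht : 0 < t) (h : (1 - t) ^ 2 ≤ v) : gapSet t v = ∅ := by
  ext r
  simp only [gapSet, mem_ofPred_eq, mem_empty_iff_false, iff_false, not_and, not_lt]
  exact fun _ => (gap_le ht r).trans h

lemma exists_gapSet_eq_Ioo (ht : 0 < t) (h : v ≤ (1 - t) ^ 2) :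
    ∃ Y, 0 ≤ Y ∧ 2 * t * Real.cosh Y = 1 + t ^ 2 - v ∧ gapSet t v = Ioo 0 Y := by
  have h2 : 0 < 2 * t := by positivity
  obtain ⟨Y, hY, h'⟩ := exists_cosh_eq (x := (1 + t ^ 2 - v) / (2 * t))
    ((one_le_div₀ h2).2 (by linarith))
  have h'' : 2 * t * Real.cosh Y = 1 + t ^ 2 - v := by
    rw [h']
    field_simp
  exact ⟨Y, hY, h'', gapSet_eq_Ioo ht hY h''⟩

lemma gapSet_zero (ht : 0 < t) : gapSet t 0 = Ioo 0 |Real.log t| := by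
  refine gapSet_eq_Ioo ht (abs_nonneg _) ?_
  rw [Real.cosh_abs, Real.cosh_log ht]
  field_simp
  ring

lemma exists_integral_cosh_mul_truncPow_eq (α : ℕ) : ∃ κ : ℝ, ∀ t v : ℝ, 0 < t → 0 ≤ v →
    ∫ r in gapSet t 0, Real.cosh (α * r) * truncPow α (gap t r - v)
      = κ * t ^ α * ∫ r in gapSet t v, Real.sinh r ^ (2 * α) := by
  obtain ⟨κ, hκ⟩ := exists_coshIntegral_self_eq α
  refine ⟨2 ^ α * κ, fun t v ht hv => ?_⟩
  rw [setIntegral_eq_of_subset_of_forall_sdiff_eq_zero (s := gapSet t v)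
    (measurableSet_gapSet t 0) (fun r hr => ⟨hr.1, hv.trans_lt hr.2⟩) (fun r hr => by
      have : ¬ v < gap t r := fun h => hr.2 ⟨hr.1.1, h⟩
      rw [truncPow, if_neg (by linarith), mul_zero])]
  rcases le_total ((1 - t) ^ 2) v with h | h
  · simp [gapSet_eq_empty ht h]
  · obtain ⟨Y, hY, hc, hs⟩ := exists_gapSet_eq_Ioo ht h
    have e : ∀ r ∈ gapSet t v, Real.cosh (α * r) * truncPow α (gap t r - v)
        = (2 * t) ^ α * ((Real.cosh Y - Real.cosh r) ^ α * Real.cosh (α * r)) := by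
      intro r hr
      rw [truncPow, if_pos (sub_pos.2 hr.2), show gap t r - v
        = 2 * t * (Real.cosh Y - Real.cosh r) by rw [gap]; linarith, mul_pow]
      ring
    rw [setIntegral_congr_fun (measurableSet_gapSet t v) e, hs, integral_const_mul,
      ← integral_Ioc_eq_integral_Ioo, ← integral_Ioc_eq_integral_Ioo,
      ← intervalIntegral.integral_of_le hY, ← intervalIntegral.integral_of_le hY]
    have := hκ Y
    rw [coshIntegral] at this
    rw [this]
    ring

lemma rpow_sub_half_mul_self {w : ℝ} (hw : 0 < w) (α : ℕ) :
    (w ^ 2) ^ ((α : ℝ) - 1 / 2) * w = w ^ (2 * α) := by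
  rw [← Real.rpow_natCast w 2, ← Real.rpow_mul hw.le, ← Real.rpow_natCast w (2 * α)]
  nth_rewrite 2 [← Real.rpow_one w]
  rw [← Real.rpow_add hw]
  congr 1
  push_cast
  ring

/-- The elliptic kernel as a function of `s`, transported to the variable `r` with
`s ^ 2 = gap t r`. -/
lemma integral_elliptic_eq (α : ℕ) {σ : ℝ} (ht : 0 < t) (hσ : 0 < σ) :
    IntegrableOn (fun s => (((1 + t) ^ 2 - s ^ 2) * ((1 - t) ^ 2 - s ^ 2)) ^ ((α : ℝ) - 1 / 2)
        * (2 * s)) (Ioo σ |1 - t|) ∧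
      ∫ s in Ioo σ |1 - t|,
          (((1 + t) ^ 2 - s ^ 2) * ((1 - t) ^ 2 - s ^ 2)) ^ ((α : ℝ) - 1 / 2) * (2 * s)
        = (2 * t) ^ (2 * α) * ∫ r in gapSet t (σ ^ 2), Real.sinh r ^ (2 * α) := by
  rcases le_total |1 - t| σ with h | h
  · rw [Ioo_eq_empty (not_lt.2 h), gapSet_eq_empty ht (by
      rw [← sq_abs]
      exact pow_le_pow_left₀ (abs_nonneg _) h 2)]
    simp
  obtain ⟨Y, hY, hc, hs⟩ := exists_gapSet_eq_Ioo (v := σ ^ 2) ht (by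
    rw [← sq_abs (1 - t)]
    exact pow_le_pow_left₀ hσ.le h 2)
  have hpos : ∀ r ∈ Ioo 0 Y, σ ^ 2 < gap t r := fun r hr => by
    rw [← hs] at hr
    exact hr.2
  have hpos0 : ∀ r ∈ Ioo 0 Y, 0 < gap t r := fun r hr =>
    (by positivity : 0 < σ ^ 2).trans (hpos r hr)
  have hsqrt : ∀ r ∈ Ioo 0 Y, √(gap t r) ^ 2 = gap t r := fun r hr => Real.sq_sqrt (hpos0 r hr).le
  have hder : ∀ r ∈ Ioo 0 Y, HasDerivWithinAt (fun r => √(gap t r))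
      (-(2 * t * Real.sinh r) / (2 * √(gap t r))) (Ioo 0 Y) r := fun r hr => by
    have : HasDerivAt (gap t) (-(2 * t * Real.sinh r)) r :=
      ((Real.hasDerivAt_cosh r).const_mul (2 * t)).const_sub (1 + t ^ 2)
    exact (this.sqrt (hpos0 r hr).ne').hasDerivWithinAt
  have hinj : InjOn (fun r => √(gap t r)) (Ioo 0 Y) := fun r hr r' hr' h => by
    have h1 : gap t r = gap t r' := by
      rw [← hsqrt r hr, ← hsqrt r' hr']
      exact congrArg (· ^ 2) h
    have h2 : Real.cosh r = Real.cosh r' := by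
      rw [gap, gap] at h1
      have : 2 * t * Real.cosh r = 2 * t * Real.cosh r' := by linarith
      exact mul_left_cancel₀ (by positivity) this
    exact Real.cosh_strictMonoOn.injOn hr.1.le hr'.1.le h2
  have himg : (fun r => √(gap t r)) '' Ioo 0 Y = Ioo σ |1 - t| := by
    ext s
    constructor
    · rintro ⟨r, hr, rfl⟩
      refine ⟨Real.lt_sqrt_of_sq_lt (hpos r hr), ?_⟩
      rw [← Real.sqrt_sq_eq_abs]
      refine Real.sqrt_lt_sqrt (hpos0 r hr).le ?_
      rw [gap_eq]
      have := mul_pos (mul_pos two_pos ht) (sub_pos.2 (Real.one_lt_cosh.2 hr.1.ne'))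
      linarith
    · intro hs'
      have hs0 : 0 < s := hσ.trans hs'.1
      have hlt : s ^ 2 < (1 - t) ^ 2 := by
        rw [← sq_abs (1 - t)]
        exact pow_lt_pow_left₀ hs'.2 hs0.le two_ne_zero
      obtain ⟨r, hr, hrc, -⟩ := exists_gapSet_eq_Ioo (v := s ^ 2) ht hlt.le
      have hg : gap t r = s ^ 2 := by
        rw [gap]
        linarith
      have hr0 : r ≠ 0 := by
        rintro rfl
        rw [gap_eq, Real.cosh_zero] at hg
        linarith
      refine ⟨r, ?_, ?_⟩
      · rw [← hs]
        refine ⟨lt_of_le_of_ne hr hr0.symm, ?_⟩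
        rw [hg]
        exact pow_lt_pow_left₀ hs'.1 hσ.le two_ne_zero
      · simp only [hg]
        exact Real.sqrt_sq hs0.le
  have hval : ∀ r ∈ Ioo 0 Y, |-(2 * t * Real.sinh r) / (2 * √(gap t r))| •
      ((((1 + t) ^ 2 - √(gap t r) ^ 2) * ((1 - t) ^ 2 - √(gap t r) ^ 2)) ^ ((α : ℝ) - 1 / 2)
        * (2 * √(gap t r))) = (2 * t) ^ (2 * α) * Real.sinh r ^ (2 * α) := fun r hr => by
    have hw : 0 < 2 * t * Real.sinh r := by
      have := Real.sinh_pos_iff.2 hr.1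
      positivity
    have hq : 0 < 2 * √(gap t r) := by
      have := Real.sqrt_pos.2 (hpos0 r hr)
      positivity
    rw [hsqrt r hr, show ((1 + t) ^ 2 - gap t r) * ((1 - t) ^ 2 - gap t r)
      = (2 * t * Real.sinh r) ^ 2 by
        rw [gap]
        linear_combination (-4 * t ^ 2) * Real.sinh_sq r,
      abs_div, abs_neg, abs_of_pos hw, abs_of_pos hq, smul_eq_mul, ← mul_pow,
      ← rpow_sub_half_mul_self hw]
    rw [mul_comm (_ ^ _) (2 * √_), ← mul_assoc, div_mul_cancel₀ _ hq.ne', mul_comm]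
  constructor
  · rw [← himg, integrableOn_image_iff_integrableOn_abs_deriv_smul measurableSet_Ioo hder hinj,
      integrableOn_congr_fun hval measurableSet_Ioo]
    exact (Continuous.integrableOn_Icc (by fun_prop)).mono_set Ioo_subset_Icc_self
  · rw [← himg, integral_image_eq_integral_abs_deriv_smul measurableSet_Ioo hder hinj,
      setIntegral_congr_fun measurableSet_Ioo hval, hs, integral_const_mul]

end GapSet

/-- The sign distinguishing the two sides of `t = 1`. -/
noncomputable def sideSign (t : ℝ) : ℝ := if t < 1 then 1 else -1

lemma measurable_sideSign : Measurable sideSign :=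
  Measurable.ite measurableSet_Iio measurable_const measurable_const

lemma abs_sideSign (t : ℝ) : |sideSign t| = 1 := by
  rw [sideSign]
  split_ifs <;> simp

lemma sideSign_mul_self (t : ℝ) : sideSign t * sideSign t = 1 := by
  rw [sideSign]
  split_ifs <;> simp

lemma integral_gapSet_eq_riemannIntegral (φ : ℝ → ℝ) (α : ℕ) {t : ℝ} (ht : 0 < t) :
    ∫ r in gapSet t 0, Real.cosh (α * r) * φ (gap t r)
      = sideSign t * riemannIntegral φ α (-Real.log t) := by
  have e : ∀ r, expGap (-Real.log t) r = gap t r := fun r => by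
    rw [expGap, gap, neg_neg, Real.exp_log ht]
  rw [gapSet_zero ht, ← integral_Ioc_eq_integral_Ioo,
    ← intervalIntegral.integral_of_le (abs_nonneg _), riemannIntegral]
  simp_rw [e, mul_comm (Real.cosh _)]
  rw [sideSign]
  split_ifs with h
  · rw [abs_of_nonpos (Real.log_nonpos ht.le h.le), one_mul]
  · rw [abs_of_nonneg (Real.log_nonneg (not_lt.1 h)),
      intervalIntegral.integral_symm (-Real.log t) 0]
    have := intervalIntegral.integral_comp_neg (a := 0) (b := Real.log t)
      (fun r => φ (gap t r) * Real.cosh (α * r))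
    rw [neg_zero] at this
    rw [← this, neg_mul_neg, one_mul]
    refine intervalIntegral.integral_congr fun r _ => ?_
    simp only [gap, Real.cosh_neg, mul_neg]

section Region

variable {a b : ℝ} (ha : 0 < a)

include ha in
lemma gapSet_subset_Ioo {t v : ℝ} (ht : t ∈ Icc a b) (hv : 0 ≤ v) :
    gapSet t v ⊆ Ioo 0 ((1 + b ^ 2) / (2 * a)) := by
  rintro r ⟨hr, h⟩
  refine ⟨hr, ?_⟩
  have h1 : r < Real.cosh r := (Real.self_le_sinh_iff.2 hr.le).trans_lt (Real.sinh_lt_cosh r)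
  have ht0 : 0 < t := ha.trans_le ht.1
  rw [lt_div_iff₀ (by positivity)]
  rw [gap] at h
  have h2 : t * r < t * Real.cosh r := mul_lt_mul_of_pos_left h1 ht0
  have h3 : a * r ≤ t * r := mul_le_mul_of_nonneg_right ht.1 hr.le
  have h4 : t ^ 2 ≤ b ^ 2 := pow_le_pow_left₀ ht0.le ht.2 2
  linarith

/-- The part of the positive quadrant over `[a, b]` where `gap` is positive. -/
def gapRegion (a b : ℝ) : Set (ℝ × ℝ) := {p | p.1 ∈ Icc a b ∧ p.2 ∈ gapSet p.1 0}

lemma measurableSet_gapRegion (a b : ℝ) : MeasurableSet (gapRegion a b) :=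
  (measurable_fst measurableSet_Icc).inter ((measurable_snd measurableSet_Ioi).inter
    (measurableSet_lt measurable_const continuous_gap.measurable))

include ha in
lemma gapRegion_subset :
    gapRegion a b ⊆ Icc a b ×ˢ Ioo 0 ((1 + b ^ 2) / (2 * a)) :=
  fun _ hp => ⟨hp.1, gapSet_subset_Ioo ha hp.1 le_rfl hp.2⟩

lemma setIntegral_gapRegion {f : ℝ × ℝ → ℝ} (hf : IntegrableOn f (gapRegion a b)) :
    ∫ p in gapRegion a b, f p = ∫ t in Icc a b, ∫ r in gapSet t 0, f (t, r) := by
  rw [← integral_indicator (measurableSet_gapRegion a b), Measure.volume_eq_prod,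
    integral_prod _ ((integrable_indicator_iff (measurableSet_gapRegion a b)).2 hf),
    ← integral_indicator measurableSet_Icc]
  congr 1
  funext t
  by_cases ht : t ∈ Icc a b
  · rw [indicator_of_mem ht, ← integral_indicator (measurableSet_gapSet t 0)]
    congr 1
    funext r
    by_cases hr : r ∈ gapSet t 0
    · rw [indicator_of_mem hr, indicator_of_mem (show (t, r) ∈ gapRegion a b from ⟨ht, hr⟩)]
    · rw [indicator_of_notMem hr, indicator_of_notMem fun h : (t, r) ∈ gapRegion a b => hr h.2]
  · rw [indicator_of_notMem ht]
    have : ∀ r, (gapRegion a b).indicator f (t, r) = 0 := fun r =>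
      indicator_of_notMem (fun h : (t, r) ∈ gapRegion a b => ht h.1) _
    simp [this]

variable {α : ℕ} {h : ℝ → ℝ}

/-- The integrand of the symmetry relation. -/
noncomputable def ellipticIntegrand (α : ℕ) (h : ℝ → ℝ) (s t : ℝ) : ℝ :=
  t ^ (1 - 2 * (α : ℝ)) * h t *
    ((((1 + t) ^ 2 - s ^ 2) * ((1 - t) ^ 2 - s ^ 2)) ^ ((α : ℝ) - 1 / 2))

/-- The integrand of the symmetry relation, cut off to `s < |1 - t|`, with the sign of each side. -/
noncomputable def signedIntegrand (α : ℕ) (h : ℝ → ℝ) (t s : ℝ) : ℝ :=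
  sideSign t * (t ^ (1 - 2 * (α : ℝ)) * h t) * (Iio |1 - t|).indicator (fun s =>
    (((1 + t) ^ 2 - s ^ 2) * ((1 - t) ^ 2 - s ^ 2)) ^ ((α : ℝ) - 1 / 2) * (2 * s)) s

lemma signedIntegrand_eq {s : ℝ} (hs : 0 < s) (t : ℝ) :
    signedIntegrand α h t s = 2 * s * ((Iio (1 - s)).indicator (ellipticIntegrand α h s) t
      - (Ioi (1 + s)).indicator (ellipticIntegrand α h s) t) := by
  rw [signedIntegrand, sideSign]
  split_ifs with ht
  · rw [abs_of_pos (sub_pos.2 ht), indicator_of_notMem (s := Ioi (1 + s)) (by simp; linarith)]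
    by_cases h' : t < 1 - s
    · rw [indicator_of_mem (show s ∈ Iio (1 - t) by simp; linarith),
        indicator_of_mem (show t ∈ Iio (1 - s) from h'), ellipticIntegrand]
      ring
    · rw [indicator_of_notMem (show s ∉ Iio (1 - t) by simp; linarith),
        indicator_of_notMem (show t ∉ Iio (1 - s) from h')]
      ring
  · rw [abs_of_nonpos (by linarith), indicator_of_notMem (s := Iio (1 - s)) (by simp; linarith)]
    by_cases h' : 1 + s < t
    · rw [indicator_of_mem (show s ∈ Iio (-(1 - t)) by simp; linarith),
        indicator_of_mem (show t ∈ Ioi (1 + s) from h'), ellipticIntegrand]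
      ring
    · rw [indicator_of_notMem (show s ∉ Iio (-(1 - t)) by simp; linarith),
        indicator_of_notMem (show t ∉ Ioi (1 + s) from h')]
      ring

lemma measurable_signedIntegrand (hm : Measurable h) :
    Measurable fun p : ℝ × ℝ => signedIntegrand α h p.1 p.2 := by
  have hset : MeasurableSet {p : ℝ × ℝ | p.2 < |1 - p.1|} :=
    measurableSet_lt (by fun_prop) (by fun_prop)
  have h1 : Measurable ({p : ℝ × ℝ | p.2 < |1 - p.1|}.indicator fun p : ℝ × ℝ =>
      (((1 + p.1) ^ 2 - p.2 ^ 2) * ((1 - p.1) ^ 2 - p.2 ^ 2)) ^ ((α : ℝ) - 1 / 2) * (2 * p.2)) := by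
    refine Measurable.indicator ?_ hset
    exact (Measurable.pow_const (by fun_prop) _).mul (by fun_prop)
  have h2 : Measurable fun p : ℝ × ℝ => sideSign p.1 * (p.1 ^ (1 - 2 * (α : ℝ)) * h p.1) :=
    (measurable_sideSign.comp measurable_fst).mul
      ((measurable_fst.pow_const _).mul (hm.comp measurable_fst))
  exact h2.mul h1

lemma rpow_one_sub_mul {t : ℝ} (ht : 0 < t) (α : ℕ) :
    t ^ (1 - 2 * (α : ℝ)) * (2 * t) ^ (2 * α) = 4 ^ α * t := by
  have : t ^ (1 - 2 * (α : ℝ)) * t ^ (2 * α) = t := by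
    rw [← Real.rpow_natCast t (2 * α), ← Real.rpow_add ht]
    simp
  rw [mul_pow, pow_mul 2 2 α]
  norm_num
  linear_combination 4 ^ α * this

lemma signedIntegrand_slice {t σ : ℝ} (ht : 0 < t) (ht2 : t < 2) (hσ : 0 < σ) :
    IntegrableOn (signedIntegrand α h t) (Ioo σ 1) ∧
      ∫ s in Ioo σ 1, signedIntegrand α h t s
        = 4 ^ α * (sideSign t * (t * h t) * ∫ r in gapSet t (σ ^ 2), Real.sinh r ^ (2 * α)) ∧
      ∫ s in Ioo σ 1, ‖signedIntegrand α h t s‖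
        = 4 ^ α * (|t * h t| * ∫ r in gapSet t (σ ^ 2), Real.sinh r ^ (2 * α)) := by
  obtain ⟨h1, h2⟩ := integral_elliptic_eq α ht hσ
  have hlt : |1 - t| ≤ 1 := abs_le.2 ⟨by linarith, by linarith⟩
  have hset : Ioo σ 1 ∩ Iio |1 - t| = Ioo σ |1 - t| := by
    rw [Ioo_inter_Iio, min_eq_right hlt]
  have hr := rpow_one_sub_mul ht α
  refine ⟨?_, ?_, ?_⟩
  · refine Integrable.const_mul ?_ _
    rw [integrable_indicator_iff measurableSet_Iio, IntegrableOn,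
      Measure.restrict_restrict measurableSet_Iio, inter_comm, hset]
    exact h1
  · simp only [signedIntegrand]
    rw [integral_const_mul, setIntegral_indicator measurableSet_Iio, hset, h2]
    linear_combination (sideSign t * h t * ∫ r in gapSet t (σ ^ 2), Real.sinh r ^ (2 * α)) * hr
  · have e : ∀ s ∈ Ioo σ 1, ‖signedIntegrand α h t s‖ = |t ^ (1 - 2 * (α : ℝ)) * h t| *
        (Iio |1 - t|).indicator (fun s =>
          (((1 + t) ^ 2 - s ^ 2) * ((1 - t) ^ 2 - s ^ 2)) ^ ((α : ℝ) - 1 / 2) * (2 * s)) s := by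
      intro s hs
      have hs0 : 0 < s := hσ.trans hs.1
      rw [signedIntegrand, norm_mul, norm_mul, Real.norm_eq_abs, abs_sideSign, one_mul,
        Real.norm_eq_abs, Real.norm_of_nonneg]
      refine indicator_apply_nonneg fun hs' => ?_
      have hs' : s < |1 - t| := hs'
      have k1 : 0 ≤ (1 - t) ^ 2 - s ^ 2 := by
        rw [← sq_abs (1 - t)]
        exact sub_nonneg.2 (pow_le_pow_left₀ hs0.le hs'.le 2)
      have k2 : 0 ≤ (1 + t) ^ 2 - s ^ 2 := by nlinarith
      have := Real.rpow_nonneg (mul_nonneg k2 k1) ((α : ℝ) - 1 / 2)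
      positivity
    rw [setIntegral_congr_fun measurableSet_Ioo e, integral_const_mul,
      setIntegral_indicator measurableSet_Iio, hset, h2, abs_mul, abs_mul, abs_of_pos ht,
      abs_of_pos (Real.rpow_pos_of_pos ht _)]
    linear_combination (|h t| * ∫ r in gapSet t (σ ^ 2), Real.sinh r ^ (2 * α)) * hr

variable (hb : b < 2) (hh : Continuous h) (h0 : ∀ t, t ∉ Icc a b → h t = 0)
  (hrange : ∀ s ∈ Ioo (0 : ℝ) 1, ∫ t in (0 : ℝ)..(1 - s), ellipticIntegrand α h s t
    = ∫ t in (1 + s)..(2 : ℝ), ellipticIntegrand α h s t)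

include ha hb hh in
lemma integrable_signedIntegrand {σ : ℝ} (hσ : 0 < σ) :
    Integrable (fun p : ℝ × ℝ => signedIntegrand α h p.1 p.2)
      ((volume.restrict (Icc a b)).prod (volume.restrict (Ioo σ 1))) := by
  have hmeas : AEStronglyMeasurable (fun p : ℝ × ℝ => signedIntegrand α h p.1 p.2)
      ((volume.restrict (Icc a b)).prod (volume.restrict (Ioo σ 1))) :=
    (measurable_signedIntegrand hh.measurable).aestronglyMeasurable
  set M := (1 + b ^ 2) / (2 * a)
  have hsinh : IntegrableOn (fun r => Real.sinh r ^ (2 * α)) (Ioo 0 M) :=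
    (Continuous.integrableOn_Icc (by fun_prop)).mono_set Ioo_subset_Icc_self
  obtain ⟨C, hC⟩ := isCompact_Icc.exists_bound_of_continuousOn
    (f := fun t => t * h t) (s := Icc a b) (by fun_prop)
  rw [integrable_prod_iff hmeas]
  refine ⟨?_, Integrable.of_bound (hmeas.norm.integral_prod_right')
    (4 ^ α * (C * ∫ r in Ioo 0 M, Real.sinh r ^ (2 * α))) ?_⟩
  · filter_upwards [ae_restrict_mem measurableSet_Icc] with t ht
    exact (signedIntegrand_slice (ha.trans_le ht.1) (ht.2.trans_lt hb) hσ).1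
  · filter_upwards [ae_restrict_mem measurableSet_Icc] with t ht
    rw [Real.norm_of_nonneg (integral_nonneg fun _ => norm_nonneg _),
      (signedIntegrand_slice (ha.trans_le ht.1) (ht.2.trans_lt hb) hσ).2.2]
    have hn : ∀ r : ℝ, 0 ≤ Real.sinh r ^ (2 * α) := fun r => by
      rw [pow_mul]
      positivity
    have h1 : ∫ r in gapSet t (σ ^ 2), Real.sinh r ^ (2 * α)
        ≤ ∫ r in Ioo 0 M, Real.sinh r ^ (2 * α) :=
      setIntegral_mono_set hsinh (Eventually.of_forall hn)
        (gapSet_subset_Ioo ha ht (sq_nonneg σ)).eventuallyLE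
    exact mul_le_mul_of_nonneg_left (mul_le_mul (hC t ht) h1 (integral_nonneg hn)
      ((norm_nonneg _).trans (hC t ht))) (by positivity)

include ha hb h0 hrange in
lemma integral_signedIntegrand_left {s : ℝ} (hs : s ∈ Ioo (0 : ℝ) 1)
    (hi : IntegrableOn (fun t => signedIntegrand α h t s) (Icc a b)) :
    ∫ t in Icc a b, signedIntegrand α h t s = 0 := by
  have hs2 : 2 * s ≠ 0 := by linarith [hs.1]
  have hF : ∀ t, t ∉ Icc a b → ellipticIntegrand α h s t = 0 := fun t ht => by
    rw [ellipticIntegrand, h0 t ht, mul_zero, zero_mul]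
  have hd : IntegrableOn (fun t => (2 * s)⁻¹ * signedIntegrand α h t s) (Icc a b) :=
    hi.const_mul _
  have e : ∀ t, (2 * s)⁻¹ * signedIntegrand α h t s
      = (Iio (1 - s)).indicator (ellipticIntegrand α h s) t
        - (Ioi (1 + s)).indicator (ellipticIntegrand α h s) t := fun t => by
    rw [signedIntegrand_eq hs.1, inv_mul_cancel_left₀ hs2]
  simp_rw [e] at hd
  have hi1 : IntegrableOn ((Iio (1 - s)).indicator (ellipticIntegrand α h s)) (Icc a b) := by
    refine (hd.indicator (measurableSet_Iio (a := 1 - s))).congr (Eventually.of_forall fun t => ?_)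
    by_cases ht : t < 1 - s
    · rw [indicator_of_mem (show t ∈ Iio (1 - s) from ht),
        indicator_of_notMem (s := Ioi (1 + s)) (by simp; linarith [hs.1]), sub_zero]
    · rw [indicator_of_notMem (show t ∉ Iio (1 - s) from ht),
        indicator_of_notMem (show t ∉ Iio (1 - s) from ht)]
  have hi2 : IntegrableOn ((Ioi (1 + s)).indicator (ellipticIntegrand α h s)) (Icc a b) := by
    refine (hi1.sub hd).congr (Eventually.of_forall fun t => ?_)
    simp
  simp_rw [signedIntegrand_eq hs.1]
  rw [integral_const_mul, integral_sub hi1 hi2, setIntegral_indicator measurableSet_Iio,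
    setIntegral_indicator measurableSet_Ioi]
  have hr := hrange s hs
  rw [intervalIntegral.integral_of_le (by linarith [hs.2]),
    intervalIntegral.integral_of_le (by linarith [hs.2]), integral_Ioc_eq_integral_Ioo,
    setIntegral_eq_of_subset_of_forall_sdiff_eq_zero (s := Icc a b ∩ Iio (1 - s))
      measurableSet_Ioo (fun t ht => ⟨ha.trans_le ht.1.1, ht.2⟩)
      (fun t ht => hF t fun h' => ht.2 ⟨h', ht.1.2⟩),
    setIntegral_eq_of_subset_of_forall_sdiff_eq_zero (s := Icc a b ∩ Ioi (1 + s))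
      measurableSet_Ioc (fun t ht => ⟨ht.2, (ht.1.2.trans_lt hb).le⟩)
      (fun t ht => hF t fun h' => ht.2 ⟨h', ht.1.1⟩)] at hr
  rw [hr, sub_self, mul_zero]

include ha hb hh h0 hrange in
lemma integral_sideSign_mul_sinh_eq_zero {σ : ℝ} (hσ : 0 < σ) :
    ∫ t in Icc a b, sideSign t * (t * h t) *
      ∫ r in gapSet t (σ ^ 2), Real.sinh r ^ (2 * α) = 0 := by
  have hi := integrable_signedIntegrand (α := α) ha hb hh hσ
  have h1 : ∫ t in Icc a b, ∫ s in Ioo σ 1, signedIntegrand α h t s = 0 := by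
    rw [integral_integral_swap hi]
    refine integral_eq_zero_of_ae ?_
    filter_upwards [hi.prod_left_ae, ae_restrict_mem measurableSet_Ioo] with s hs hs'
    exact integral_signedIntegrand_left ha hb h0 hrange ⟨hσ.trans hs'.1, hs'.2⟩ hs
  rw [setIntegral_congr_fun measurableSet_Icc fun t ht =>
    (signedIntegrand_slice (α := α) (h := h) (ha.trans_le ht.1) (ht.2.trans_lt hb) hσ).2.1,
    integral_const_mul] at h1
  exact (mul_eq_zero.1 h1).resolve_left (by positivity)

include ha hb hh h0 hrange in
lemma integral_riemannIntegral_eq_zero {φ φ' : ℝ → ℝ} (hφ : ∀ x, HasDerivAt φ (φ' x) x)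
    (hφ' : Continuous φ') :
    ∫ t in Icc a b, t * h t / t ^ α * riemannIntegral φ α (-Real.log t) = 0 := by
  have hφc : Continuous φ := continuous_iff_continuousAt.2 fun x => (hφ x).continuousAt
  set c : ℝ → ℝ := fun t => sideSign t * (t * h t / t ^ α)
  set M := (1 + b ^ 2) / (2 * a)
  have hc : IntegrableOn c (Icc a b) := by
    refine Integrable.bdd_mul (c := 1) (ContinuousOn.integrableOn_Icc ?_)
      measurable_sideSign.aestronglyMeasurable (Eventually.of_forall fun t => (abs_sideSign t).le)
    refine ContinuousOn.div (by fun_prop) (by fun_prop) fun t ht => ?_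
    exact (pow_pos (ha.trans_le ht.1) α).ne'
  have hcosh : IntegrableOn (fun r => Real.cosh (α * r)) (Ioo 0 M) :=
    (Continuous.integrableOn_Icc (by fun_prop)).mono_set Ioo_subset_Icc_self
  have hg : IntegrableOn (fun p : ℝ × ℝ => c p.1 * Real.cosh (α * p.2)) (gapRegion a b) := by
    have := hc.mul_prod hcosh
    rw [Measure.prod_restrict] at this
    exact IntegrableOn.mono_set this (gapRegion_subset ha)
  have hX0 : ∀ᵐ p ∂(volume.restrict (gapRegion a b)), 0 < gap p.1 p.2 := by
    filter_upwards [ae_restrict_mem (measurableSet_gapRegion a b)] with p hp using hp.2.2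
  have hX1 : ∀ᵐ p ∂(volume.restrict (gapRegion a b)), gap p.1 p.2 < 1 := by
    filter_upwards [ae_restrict_mem (measurableSet_gapRegion a b)] with p hp
    have hp0 := ha.trans_le hp.1.1
    have hp2 := hp.1.2.trans_lt hb
    refine (gap_le hp0 _).trans_lt ?_
    nlinarith
  have hXm : Measurable fun p : ℝ × ℝ => gap p.1 p.2 := continuous_gap.measurable
  obtain ⟨κ, hκ⟩ := exists_integral_cosh_mul_truncPow_eq α
  have key := integral_mul_comp_eq_zero hg hXm hX0 hX1 α (fun v hv => by
    rw [setIntegral_gapRegion (integrable_mul_truncPow hg hXm hX1 α hv.1.le)]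
    have hz := integral_sideSign_mul_sinh_eq_zero ha hb hh h0 hrange (Real.sqrt_pos.2 hv.1)
    rw [Real.sq_sqrt hv.1.le] at hz
    rw [setIntegral_congr_fun (g := fun t => κ * (sideSign t * (t * h t)
      * ∫ r in gapSet t v, Real.sinh r ^ (2 * α))) measurableSet_Icc fun t ht => ?_,
      integral_const_mul, hz, mul_zero]
    have ht0 : 0 < t := ha.trans_le ht.1
    simp_rw [mul_assoc (c t)]
    rw [integral_const_mul, hκ t v ht0 hv.1.le]
    simp only [c]
    field_simp) hφ hφ'
  obtain ⟨C, hC⟩ := isCompact_Icc.exists_bound_of_continuousOn (s := Icc (0 : ℝ) 1)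
    hφc.continuousOn
  have hgφ : IntegrableOn (fun p : ℝ × ℝ => c p.1 * Real.cosh (α * p.2) * φ (gap p.1 p.2))
      (gapRegion a b) := by
    refine hg.mul_bdd (c := C) (hφc.measurable.comp hXm).aestronglyMeasurable ?_
    filter_upwards [hX0, hX1] with p h1 h2 using hC _ ⟨h1.le, h2.le⟩
  rw [setIntegral_gapRegion hgφ] at key
  rw [← key]
  refine setIntegral_congr_fun measurableSet_Icc fun t ht => ?_
  simp_rw [mul_assoc (c t)]
  rw [integral_const_mul, integral_gapSet_eq_riemannIntegral φ α (ha.trans_le ht.1)]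
  simp only [c]
  linear_combination (-(t * h t / t ^ α) * riemannIntegral φ α (-Real.log t)) * sideSign_mul_self t

end Region

lemma SolvesBessel.continuousOn_comp_mul {α : ℕ} {lam : ℝ} {f : ℝ → ℝ}
    (hf : SolvesBessel α lam fun τ => f (lam * Real.exp (-τ))) :
    ContinuousOn (fun t => f (lam * t)) (Ioi 0) := by
  have h1 : ContinuousOn (fun t : ℝ => -Real.log t) (Ioi 0) :=
    (Real.continuousOn_log.mono fun t (ht : 0 < t) => ht.ne').neg
  refine (hf.continuous.comp_continuousOn h1).congr fun t (ht : 0 < t) => ?_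
  simp only [Function.comp, neg_neg, Real.exp_log ht]

/-- The cross product of the normalized Bessel functions is a multiple of a Riemann integral. -/
lemma exists_cross_product_eq (α : ℕ) {lam : ℝ} (hlam : 0 < lam) : ∃ c : ℝ, ∀ t : ℝ, 0 < t →
    bessely α lam * besselj α (lam * t) - besselj α lam * bessely α (lam * t)
      = c * (riemannIntegral (powSer (riemannCoeff lam)) α (-Real.log t) / t ^ α) := by
  have hu := ((solvesBessel_besselJ α lam).const_mul (besselY α lam)).sub
    ((solvesBessel_besselY α hlam).const_mul (besselJ α lam))
  have hr := entireCoeff_riemannCoeff lam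
  obtain ⟨c, hc⟩ := hu.exists_eq_mul_riemannIntegral hr.hasDerivAt hr.shift.hasDerivAt
    hr.shift.shift.continuous (by simp; ring) (powSer_riemannCoeff_zero lam)
    (powSer_riemannCoeff_ode lam)
  refine ⟨(2 ^ α * (Nat.factorial α : ℝ) / lam ^ α) ^ 2 * c, fun t ht => ?_⟩
  have h := hc (-Real.log t)
  simp only [neg_neg, Real.exp_log ht] at h
  rw [mul_assoc, ← mul_div_assoc c, ← h]
  simp only [besselj, bessely, mul_pow lam]
  field_simp

lemma exists_Icc_of_isCompact_subset_Ioo {K : Set ℝ} {x y : ℝ} (hK : IsCompact K)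
    (hxy : x < y) (h : K ⊆ Ioo x y) : ∃ a b, x < a ∧ b < y ∧ K ⊆ Icc a b := by
  rcases K.eq_empty_or_nonempty with rfl | hne
  · exact ⟨y, x, hxy, hxy, empty_subset _⟩
  · obtain ⟨a, haK, ha⟩ := hK.exists_isLeast hne
    obtain ⟨b, hbK, hb⟩ := hK.exists_isGreatest hne
    exact ⟨a, b, (h haK).1, (h hbK).2, fun t ht => ⟨ha ht, hb ht⟩⟩

/-- **Cross product identity for Bessel functions of integer order**
(Theorem `CP-Identity`).  If `h ∈ C_c^∞((0,2))` satisfies the elliptic-integral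
symmetry relation for every `s ∈ (0,1)`, then for every `λ > 0`,
`y_α(λ) ∫_0^2 t h(t) j_α(λt) dt = j_α(λ) ∫_0^2 t h(t) y_α(λt) dt`. -/
theorem bessel_cross_product_identity
    (α : ℕ)
    (h : ℝ → ℝ) (hsmooth : ContDiff ℝ (⊤ : ℕ∞) h)
    (hcpt : HasCompactSupport h) (hsupp : tsupport h ⊆ Set.Ioo 0 2)
    (hrange : ∀ s ∈ Set.Ioo (0 : ℝ) 1,
      (∫ t in (0 : ℝ)..(1 - s),
          t ^ (1 - 2 * (α : ℝ)) * h t *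
            ((((1 + t) ^ 2 - s ^ 2) * ((1 - t) ^ 2 - s ^ 2)) ^ ((α : ℝ) - 1 / 2)))
        = ∫ t in (1 + s)..(2 : ℝ),
            t ^ (1 - 2 * (α : ℝ)) * h t *
              ((((1 + t) ^ 2 - s ^ 2) * ((1 - t) ^ 2 - s ^ 2)) ^ ((α : ℝ) - 1 / 2))) :
    ∀ lam : ℝ, 0 < lam →
      bessely α lam * (∫ t in (0 : ℝ)..2, t * h t * besselj α (lam * t))
        = besselj α lam * ∫ t in (0 : ℝ)..2, t * h t * bessely α (lam * t) := by
  intro lam hlam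
  have hh : Continuous h := hsmooth.continuous
  obtain ⟨a, b, ha, hb, hab⟩ := exists_Icc_of_isCompact_subset_Ioo hcpt two_pos hsupp
  have h0 : ∀ t, t ∉ Icc a b → h t = 0 := fun t ht =>
    image_eq_zero_of_notMem_tsupport fun h' => ht (hab h')
  have hpos : Icc a b ⊆ Ioi 0 := fun t ht => ha.trans_le ht.1
  have hint : ∀ f : ℝ → ℝ, ∫ t in (0 : ℝ)..2, t * h t * f t = ∫ t in Icc a b, t * h t * f t := by
    intro f
    rw [intervalIntegral.integral_of_le zero_le_two]
    exact setIntegral_eq_of_subset_of_forall_sdiff_eq_zero measurableSet_Ioc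
      (fun t ht => ⟨hpos ht, (ht.2.trans_lt hb).le⟩) fun t ht => by rw [h0 t ht.2]; ring
  have hpow : ContinuousOn (fun t => (lam * t) ^ α) (Icc a b) := by fun_prop
  have hpow0 : ∀ t ∈ Icc a b, (lam * t) ^ α ≠ 0 := fun t ht =>
    (pow_pos (mul_pos hlam (hpos ht)) α).ne'
  have hj : IntegrableOn (fun t => t * h t * besselj α (lam * t)) (Icc a b) :=
    (ContinuousOn.mul (by fun_prop) ((((solvesBessel_besselJ α lam).continuousOn_comp_mul.mono
      hpos).const_mul _).div hpow hpow0)).integrableOn_Icc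
  have hy : IntegrableOn (fun t => t * h t * bessely α (lam * t)) (Icc a b) :=
    (ContinuousOn.mul (by fun_prop) ((((solvesBessel_besselY α hlam).continuousOn_comp_mul.mono
      hpos).const_mul _).div hpow hpow0)).integrableOn_Icc
  obtain ⟨c, hc⟩ := exists_cross_product_eq α hlam
  have hr := entireCoeff_riemannCoeff lam
  have hz := integral_riemannIntegral_eq_zero ha hb hh h0 hrange hr.hasDerivAt
    hr.shift.continuous
  rw [hint, hint, ← sub_eq_zero, ← integral_const_mul, ← integral_const_mul,
    ← integral_sub (hj.const_mul _) (hy.const_mul _),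
    setIntegral_congr_fun (g := fun t => c * (t * h t / t ^ α
      * riemannIntegral (powSer (riemannCoeff lam)) α (-Real.log t))) measurableSet_Icc
      fun t ht => ?_, integral_const_mul, hz, mul_zero]
  linear_combination t * h t * hc t (hpos ht)
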